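/- Suppose that under the flow one has ω(t) = 0 and |e| ≤ L(t) ≤ L₀ for all t ∈ [0,T), where L₀ = L(0). Then for every ℓ ∈ ℕ there exists a constant C > 0, depending only on ℓ, L₀, |e| and the initial data γ(·,0), such that ‖k_{s^ℓ}(·,t)‖₂² ≤ ‖k_{s^ℓ}(·,0)‖₂² + C for all t ∈ [0,T); consequently all arc length derivatives of curvature are bounded in L², uniformly in time. -/

import Mathlib

noncomputable section

open Real Set MeasureTheory intervalIntegral
open scoped ENNReal RealInnerProductSpace

/-- The Euclidean plane. -/
abbrev E2 : Type := EuclideanSpace ℝ (Fin 2)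

/-- Counterclockwise rotation by `π/2`. -/
def rot (v : E2) : E2 := (WithLp.equiv 2 (Fin 2 → ℝ)).symm ![-(v 1), v 0]

/-- Arc length derivative `∂ₛ = |∂ₓγ|⁻¹ ∂ₓ` of a scalar function along the curve `γ`. -/
def aderiv (γ : ℝ → E2) (f : ℝ → ℝ) (x : ℝ) : ℝ := (‖deriv γ x‖)⁻¹ * deriv f x

/-- Iterated arc length derivative. -/
def aderivIter (γ : ℝ → E2) : ℕ → (ℝ → ℝ) → (ℝ → ℝ)
  | 0, f => f
  | n + 1, f => aderiv γ (aderivIter γ n f)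

/-- Arc length derivative of a vector-valued function along `γ`. -/
def aderivVec (γ : ℝ → E2) (f : ℝ → E2) (x : ℝ) : E2 := (‖deriv γ x‖)⁻¹ • deriv f x

/-- Unit tangent vector `τ = ∂ₛ γ`. -/
def utangent (γ : ℝ → E2) (x : ℝ) : E2 := aderivVec γ γ x

/-- Unit normal `ν`, the counterclockwise rotation of `τ` by `π/2`. -/
def unormal (γ : ℝ → E2) (x : ℝ) : E2 := rot (utangent γ x)

/-- Scalar curvature `k = ⟨∂ₛτ, ν⟩`. -/
def curv (γ : ℝ → E2) (x : ℝ) : ℝ := ⟪aderivVec γ (utangent γ) x, unormal γ x⟫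

/-- `j`-th arc length derivative of the curvature, `k_{s^j}`. -/
def kds (γ : ℝ → E2) (j : ℕ) : ℝ → ℝ := aderivIter γ j (curv γ)

/-- The normal speed `F = k_{s⁴} + k² k_{ss} - (1/2) k k_s²`. -/
def speedF (γ : ℝ → E2) (x : ℝ) : ℝ :=
  kds γ 4 x + (curv γ x) ^ 2 * kds γ 2 x - (1 / 2) * curv γ x * (kds γ 1 x) ^ 2

/-- `∫_γ f ds`, the integral of `f` along `γ : [-1,1] → ℝ²` with respect to arc length. -/
def cint (γ : ℝ → E2) (f : ℝ → ℝ) : ℝ := ∫ x in (-1:ℝ)..1, f x * ‖deriv γ x‖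

/-- The length of `γ`. -/
def clen (γ : ℝ → E2) : ℝ := cint γ (fun _ => 1)

/-- `‖k_{s^j}‖₂² = ∫_γ k_{s^j}² ds`. -/
def knorm2 (γ : ℝ → E2) (j : ℕ) : ℝ := cint γ (fun x => (kds γ j x) ^ 2)

/-- Total curvature `∫_γ k ds`. -/
def totalK (γ : ℝ → E2) : ℝ := cint γ (curv γ)

/-- The time interval `[0, T)`, `T ∈ (0, ∞]`. -/
def inTime (T : ℝ≥0∞) (t : ℝ) : Prop := 0 ≤ t ∧ ENNReal.ofReal t < T

/-- A smooth family of regular plane curves `γ : [-1,1] × [0,T) → ℝ²` moving with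
normal speed `F = k_{s⁴} + k² k_{ss} - (1/2) k k_s²`, i.e. `∂ₜγ = F ν`. -/
structure SixthFlow (T : ℝ≥0∞) where
  Tpos : 0 < T
  γ : ℝ → ℝ → E2
  smooth : ContDiff ℝ (⊤ : ℕ∞) (Function.uncurry γ)
  regular : ∀ ⦃t x : ℝ⦄, inTime T t → x ∈ Icc (-1:ℝ) 1 → deriv (γ t) x ≠ 0
  flow : ∀ ⦃t x : ℝ⦄, inTime T t → x ∈ Icc (-1:ℝ) 1 →
    HasDerivWithinAt (fun u => γ u x) (speedF (γ t) x • unormal (γ t) x) (Ici 0) t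

/-- The boundary conditions: the endpoints of the curve lie on two fixed parallel vertical
lines at distance `|e| > 0` (at abscissae `lineMinus` and `linePlus`), the curve meets these
lines perpendicularly (Neumann condition: the unit normal of the curve is orthogonal to the
unit normal `(1,0)` of the lines), and `k_s = k_{sss} = 0` at both endpoints. -/
structure BC {T : ℝ≥0∞} (Φ : SixthFlow T) (e : ℝ) where
  he : e ≠ 0
  lineMinus : ℝ
  linePlus : ℝ
  hdist : |linePlus - lineMinus| = |e|
  onLeft : ∀ ⦃t : ℝ⦄, inTime T t → Φ.γ t (-1) 0 = lineMinus
  onRight : ∀ ⦃t : ℝ⦄, inTime T t → Φ.γ t 1 0 = linePlus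
  neumann : ∀ ⦃t : ℝ⦄, inTime T t →
    unormal (Φ.γ t) (-1) 0 = 0 ∧ unormal (Φ.γ t) 1 0 = 0
  noflux : ∀ ⦃t : ℝ⦄, inTime T t →
    kds (Φ.γ t) 1 (-1) = 0 ∧ kds (Φ.γ t) 1 1 = 0
  noflux3 : ∀ ⦃t : ℝ⦄, inTime T t →
    kds (Φ.γ t) 3 (-1) = 0 ∧ kds (Φ.γ t) 3 1 = 0

section Polynomials

open MvPolynomial

/-- The formal arc length derivative on polynomials in `k, k_s, k_{ss}, …`. -/
def arcDer : Derivation ℝ (MvPolynomial ℕ ℝ) (MvPolynomial ℕ ℝ) :=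
  mkDerivation ℝ fun j => X (j + 1)

@[simp] lemma arcDer_X (j : ℕ) : arcDer (X j) = X (j + 1) := by
  simp [arcDer, mkDerivation_X]

/-- The normal speed as a polynomial in the derivatives of curvature. -/
def speedPoly : MvPolynomial ℕ ℝ :=
  X 4 + X 0 ^ 2 * X 2 - C (1 / 2) * X 0 * X 1 ^ 2

/-- The time derivative of `k_{s^m}` as a polynomial in the derivatives of curvature. -/
def evolPoly : ℕ → MvPolynomial ℕ ℝ
  | 0 => arcDer (arcDer speedPoly) + X 0 ^ 2 * speedPoly
  | m + 1 => arcDer (evolPoly m) + X 0 * speedPoly * X (m + 1)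

/-- Polynomials all of whose monomials carry a number of derivatives that is at most `d` and
has the parity of `d`. -/
inductive HasWeight : ℕ → MvPolynomial ℕ ℝ → Prop
  | const (c : ℝ) : HasWeight 0 (C c)
  | add {d : ℕ} {P Q : MvPolynomial ℕ ℝ} :
      HasWeight d P → HasWeight d Q → HasWeight d (P + Q)
  | X_mul (j : ℕ) {d : ℕ} {P : MvPolynomial ℕ ℝ} :
      HasWeight d P → HasWeight (j + d) (X j * P)
  | lift {d : ℕ} {P : MvPolynomial ℕ ℝ} : HasWeight d P → HasWeight (d + 2) P

namespace HasWeight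

variable {d e : ℕ} {P Q : MvPolynomial ℕ ℝ}

lemma of_eq (h : HasWeight d P) (hd : d = e) (hP : P = Q) : HasWeight e Q := hd ▸ hP ▸ h

lemma X (j : ℕ) : HasWeight j (MvPolynomial.X j) :=
  (X_mul j (const 1)).of_eq (by simp) (by simp)

lemma zero (d : ℕ) : HasWeight d 0 :=
  (X_mul d (const 0)).of_eq (by simp) (by simp)

lemma C_mul (c : ℝ) (h : HasWeight d P) : HasWeight d (C c * P) := by
  induction h with
  | const a => exact (const (c * a)).of_eq rfl (by simp)
  | add _ _ h₁ h₂ => exact (h₁.add h₂).of_eq rfl (by ring)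
  | X_mul j _ h => exact (X_mul j h).of_eq rfl (by ring)
  | lift _ h => exact h.lift

lemma neg (h : HasWeight d P) : HasWeight d (-P) :=
  (h.C_mul (-1)).of_eq rfl (by simp)

lemma sub (hP : HasWeight d P) (hQ : HasWeight d Q) : HasWeight d (P - Q) :=
  (hP.add hQ.neg).of_eq rfl (by ring)

lemma mul (hP : HasWeight d P) (hQ : HasWeight e Q) : HasWeight (d + e) (P * Q) := by
  induction hP with
  | const c => exact (hQ.C_mul c).of_eq (by simp) rfl
  | add _ _ h₁ h₂ => exact (h₁.add h₂).of_eq rfl (by ring)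
  | X_mul j _ h => exact (X_mul j h).of_eq (by ring) (by ring)
  | lift _ h => exact h.lift.of_eq (by ring) rfl

lemma arcDer (h : HasWeight d P) : HasWeight (d + 1) (arcDer P) := by
  induction h with
  | const c => exact (zero 1).of_eq rfl (by simp [_root_.arcDer])
  | add _ _ h₁ h₂ => exact (h₁.add h₂).of_eq rfl (by simp)
  | X_mul j hP h =>
    refine ((X_mul (j + 1) hP).of_eq (by ring) rfl |>.add
      ((X_mul j h).of_eq (by ring) rfl)).of_eq rfl ?_
    simp [Derivation.leibniz]; ring
  | lift _ h => exact h.lift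

lemma eval_eq_zero (h : HasWeight d P) (hd : Odd d) {c : ℕ → ℝ}
    (hc : ∀ j, Odd j → j ≤ d → c j = 0) : eval c P = 0 := by
  induction h with
  | const c => simp at hd
  | add _ _ h₁ h₂ => simp [h₁ hd hc, h₂ hd hc]
  | @X_mul j d P _ h =>
    rcases Nat.even_or_odd j with hj | hj
    · have hd' : Odd d := by
        rcases hj with ⟨a, rfl⟩; rcases hd with ⟨b, hb⟩; exact ⟨b - a, by omega⟩
      simp [h hd' fun i hi hid => hc i hi (by omega)]
    · simp [hc j hj (by omega)]
  | @lift d P _ h =>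
    refine h ?_ fun j hj hjd => hc j hj (by omega)
    rcases hd with ⟨b, hb⟩; exact ⟨b - 1, by omega⟩

end HasWeight

lemma hasWeight_speedPoly_sub : HasWeight 2 (speedPoly - X 4) := by
  refine (((HasWeight.X 0).mul ((HasWeight.X 0).mul (HasWeight.X 2))).sub
    ((((HasWeight.X 0).mul ((HasWeight.X 1).mul (HasWeight.X 1)))).C_mul (1 / 2))).of_eq rfl ?_
  rw [speedPoly]; ring

lemma hasWeight_speedPoly : HasWeight 4 speedPoly :=
  (hasWeight_speedPoly_sub.lift.add (HasWeight.X 4)).of_eq rfl (by ring)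

lemma hasWeight_evolPoly_sub (m : ℕ) : HasWeight (m + 4) (evolPoly m - X (m + 6)) := by
  induction m with
  | zero =>
    refine (hasWeight_speedPoly_sub.arcDer.arcDer.add
      ((HasWeight.X 0).mul ((HasWeight.X 0).mul hasWeight_speedPoly))).of_eq rfl ?_
    simp only [evolPoly, map_sub, arcDer_X]; ring
  | succ m ih =>
    refine (ih.arcDer.add (((HasWeight.X 0).mul hasWeight_speedPoly).mul
      (HasWeight.X (m + 1)) |>.of_eq (by ring) rfl)).of_eq (by ring) ?_
    simp only [evolPoly, map_sub, arcDer_X]; ring_nf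

/-- Divergence form of the integrand of the derivative of `‖k_s‖₂²`. -/
lemma energy_identity :
    2 * X 1 * evolPoly 1 - X 1 ^ 2 * X 0 * speedPoly =
      arcDer (2 * X 1 * arcDer (arcDer speedPoly) - 2 * X 2 * arcDer speedPoly
        + 2 * X 3 * speedPoly + 2 * X 1 * X 0 ^ 2 * speedPoly) - 2 * speedPoly ^ 2 := by
  have h2 : arcDer (2 : MvPolynomial ℕ ℝ) = 0 := by
    simpa using arcDer.map_natCast 2
  have hS : 2 * speedPoly ^ 2 = speedPoly * (2 * X 4 + 2 * X 0 ^ 2 * X 2 - X 0 * X 1 ^ 2) := by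
    have : (C (1 / 2) : MvPolynomial ℕ ℝ) * 2 = 1 := by
      rw [show (2 : MvPolynomial ℕ ℝ) = C 2 from rfl, ← C_mul]; norm_num
    have h3 : 2 * speedPoly = 2 * X 4 + 2 * X 0 ^ 2 * X 2 - X 0 * X 1 ^ 2 := by
      rw [speedPoly]; linear_combination (- X 0 * X 1 ^ 2) * this
    rw [← h3]; ring
  rw [hS]
  simp only [evolPoly, map_add, map_sub, Derivation.leibniz, smul_eq_mul, arcDer_X, h2,
    pow_two]
  ring_nf

/-- Divergence form of the integrand of the derivative of `‖k_{s^{m+1}}‖₂²`. -/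
lemma higher_energy_identity (m : ℕ) :
    2 * X (m + 1) * evolPoly (m + 1) - X (m + 1) ^ 2 * X 0 * speedPoly =
      arcDer (2 * (X (m + 1) * X (m + 6) - X (m + 2) * X (m + 5) + X (m + 3) * X (m + 4))
        + 2 * X (m + 1) * (evolPoly m - X (m + 6)))
      - 2 * X (m + 4) ^ 2 - 2 * (X (m + 2) * (evolPoly m - X (m + 6)))
      + X (m + 1) * X (m + 1) * (X 0 * speedPoly) := by
  have h2 : arcDer (2 : MvPolynomial ℕ ℝ) = 0 := by
    simpa using arcDer.map_natCast 2
  simp only [evolPoly, map_add, map_sub, Derivation.leibniz, smul_eq_mul, arcDer_X, h2]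
  ring_nf

end Polynomials
section WeightedIntegral

/-- The integral over `[-1,1]` against the density `v`. -/
def wint (v f : ℝ → ℝ) : ℝ := ∫ x in (-1:ℝ)..1, f x * v x

variable {v f g : ℝ → ℝ}

lemma intervalIntegrable_mul_density (hv : ContinuousOn v (Icc (-1) 1))
    (hf : ContinuousOn f (Icc (-1) 1)) :
    IntervalIntegrable (fun x => f x * v x) volume (-1) 1 :=
  (hf.mul hv).intervalIntegrable_of_Icc (by norm_num)

lemma wint_add (hv : ContinuousOn v (Icc (-1) 1)) (hf : ContinuousOn f (Icc (-1) 1))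
    (hg : ContinuousOn g (Icc (-1) 1)) :
    wint v (fun x => f x + g x) = wint v f + wint v g := by
  simp only [wint, add_mul]
  exact integral_add (intervalIntegrable_mul_density hv hf) (intervalIntegrable_mul_density hv hg)

lemma wint_const_mul (c : ℝ) : wint v (fun x => c * f x) = c * wint v f := by
  simp only [wint, mul_assoc, intervalIntegral.integral_const_mul]

lemma wint_sub (hv : ContinuousOn v (Icc (-1) 1)) (hf : ContinuousOn f (Icc (-1) 1))
    (hg : ContinuousOn g (Icc (-1) 1)) :
    wint v (fun x => f x - g x) = wint v f - wint v g := by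
  simp only [wint, sub_mul]
  exact integral_sub (intervalIntegrable_mul_density hv hf) (intervalIntegrable_mul_density hv hg)

lemma wint_congr (h : ∀ x ∈ Icc (-1:ℝ) 1, f x = g x) : wint v f = wint v g := by
  refine integral_congr fun x hx => ?_
  rw [uIcc_of_le (by norm_num)] at hx
  simp [h x hx]

lemma wint_mono (hv : ContinuousOn v (Icc (-1) 1)) (hv0 : ∀ x ∈ Icc (-1:ℝ) 1, 0 < v x)
    (hf : ContinuousOn f (Icc (-1) 1)) (hg : ContinuousOn g (Icc (-1) 1))
    (h : ∀ x ∈ Icc (-1:ℝ) 1, f x ≤ g x) : wint v f ≤ wint v g :=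
  integral_mono_on (by norm_num) (intervalIntegrable_mul_density hv hf)
    (intervalIntegrable_mul_density hv hg) fun x hx =>
      mul_le_mul_of_nonneg_right (h x hx) (hv0 x hx).le

lemma wint_nonneg (hv0 : ∀ x ∈ Icc (-1:ℝ) 1, 0 < v x)
    (h : ∀ x ∈ Icc (-1:ℝ) 1, 0 ≤ f x) : 0 ≤ wint v f :=
  integral_nonneg (by norm_num) fun x hx => mul_nonneg (h x hx) (hv0 x hx).le

lemma wint_mul_sq_le (hv : ContinuousOn v (Icc (-1) 1)) (hv0 : ∀ x ∈ Icc (-1:ℝ) 1, 0 < v x)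
    (hf : ContinuousOn f (Icc (-1) 1)) (hg : ContinuousOn g (Icc (-1) 1)) :
    wint v (fun x => f x * g x) ^ 2 ≤ wint v (fun x => f x ^ 2) * wint v (fun x => g x ^ 2) := by
  have h : ∀ s : ℝ, 0 ≤ wint v (fun x => g x ^ 2) * (s * s)
      + 2 * wint v (fun x => f x * g x) * s + wint v (fun x => f x ^ 2) := fun s => by
    have h0 : 0 ≤ wint v fun x => (f x + s * g x) ^ 2 :=
      wint_nonneg hv0 fun x _ => sq_nonneg _
    have h1 : wint v (fun x => (f x + s * g x) ^ 2)
        = wint v (fun x => (f x ^ 2 + (2 * s) * (f x * g x)) + (s * s) * g x ^ 2) :=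
      wint_congr fun x _ => by ring
    rw [h1, wint_add hv (by fun_prop) (by fun_prop), wint_add hv (by fun_prop) (by fun_prop),
      wint_const_mul, wint_const_mul] at h0
    linarith
  have := discrim_le_zero h
  rw [discrim] at this
  linarith

lemma wint_mul_le (hv : ContinuousOn v (Icc (-1) 1)) (hv0 : ∀ x ∈ Icc (-1:ℝ) 1, 0 < v x)
    (hf : ContinuousOn f (Icc (-1) 1)) (hg : ContinuousOn g (Icc (-1) 1)) {a b : ℝ}
    (ha : 0 ≤ a) (hb : 0 ≤ b) (hfa : wint v (fun x => f x ^ 2) ≤ a ^ 2)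
    (hgb : wint v (fun x => g x ^ 2) ≤ b ^ 2) :
    |wint v (fun x => f x * g x)| ≤ a * b := by
  refine abs_le_of_sq_le_sq ((wint_mul_sq_le hv hv0 hf hg).trans ?_) (by positivity)
  rw [mul_pow]
  exact mul_le_mul hfa hgb (wint_nonneg hv0 fun x _ => sq_nonneg _) (by positivity)

lemma exists_eq_zero_of_wint_eq_zero (hv : ContinuousOn v (Icc (-1) 1))
    (hv0 : ∀ x ∈ Icc (-1:ℝ) 1, 0 < v x) (hf : ContinuousOn f (Icc (-1) 1))
    (h : wint v f = 0) : ∃ x ∈ Icc (-1:ℝ) 1, f x = 0 := by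
  have hI : uIcc (-1:ℝ) 1 = Icc (-1) 1 := uIcc_of_le (by norm_num)
  obtain ⟨c, hc, h'⟩ := exists_eq_const_mul_intervalIntegral_of_nonneg (μ := volume)
    (f := f) (g := v) (hI ▸ hf) (hv.intervalIntegrable_of_Icc (by norm_num)) fun x hx =>
      (hv0 x (hI ▸ uIoc_subset_uIcc hx)).le
  have hpos : 0 < ∫ x in (-1:ℝ)..1, v x :=
    intervalIntegral_pos_of_pos_on (hv.intervalIntegrable_of_Icc (by norm_num))
      (fun x hx => hv0 x (Ioo_subset_Icc_self hx)) (by norm_num)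
  rw [hI] at hc
  rw [wint] at h
  exact ⟨c, hc, by simpa [hpos.ne'] using (h'.symm.trans h)⟩

end WeightedIntegral

section Profiles

open MvPolynomial

/-- The speed `v` of a parametrization of a curve over `[-1,1]` of length at most `Λ`, along
with the derivatives `κ j = k_{s^j}` of its curvature, when the total curvature is zero and all
derivatives of odd order vanish at the endpoints. -/
structure Profile (v : ℝ → ℝ) (κ : ℕ → ℝ → ℝ) (Λ : ℝ) : Prop where
  cont : ContinuousOn v (Icc (-1) 1)
  pos : ∀ x ∈ Icc (-1:ℝ) 1, 0 < v x
  hasDerivAt : ∀ j, ∀ x ∈ Icc (-1:ℝ) 1, HasDerivAt (κ j) (v x * κ (j + 1) x) x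
  odd : ∀ j, Odd j → κ j (-1) = 0 ∧ κ j 1 = 0
  mean : wint v (κ 0) = 0
  len : wint v (fun _ => 1) ≤ Λ

/-- Evaluation of a polynomial in the derivatives of curvature. -/
def evalAt (κ : ℕ → ℝ → ℝ) (P : MvPolynomial ℕ ℝ) (x : ℝ) : ℝ := eval (fun j => κ j x) P

lemma hasDerivAt_evalAt {v : ℝ → ℝ} {κ : ℕ → ℝ → ℝ} {x : ℝ}
    (h : ∀ j, HasDerivAt (κ j) (v x * κ (j + 1) x) x) (P : MvPolynomial ℕ ℝ) :
    HasDerivAt (evalAt κ P) (v x * evalAt κ (arcDer P) x) x := by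
  unfold evalAt
  induction P using MvPolynomial.induction_on with
  | C a => simpa [arcDer] using hasDerivAt_const x a
  | add P Q hP hQ => simpa only [map_add, mul_add] using hP.fun_add hQ
  | mul_X P j hP =>
    simp only [map_mul, eval_X]
    refine (hP.fun_mul (h j)).congr_deriv ?_
    simp [Derivation.leibniz]; ring

namespace Profile

variable {v : ℝ → ℝ} {κ : ℕ → ℝ → ℝ} {Λ : ℝ}

lemma continuousOn_evalAt (h : Profile v κ Λ) (P : MvPolynomial ℕ ℝ) :
    ContinuousOn (evalAt κ P) (Icc (-1) 1) := fun x hx =>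
  (hasDerivAt_evalAt (fun j => h.hasDerivAt j x hx) P).continuousAt.continuousWithinAt

lemma continuousOn (h : Profile v κ Λ) (j : ℕ) : ContinuousOn (κ j) (Icc (-1) 1) := fun x hx =>
  (h.hasDerivAt j x hx).continuousAt.continuousWithinAt

lemma wint_arcDer (h : Profile v κ Λ) (P : MvPolynomial ℕ ℝ) :
    wint v (evalAt κ (arcDer P)) = evalAt κ P 1 - evalAt κ P (-1) := by
  rw [wint, ← integral_eq_sub_of_hasDerivAt (f' := fun x => evalAt κ (arcDer P) x * v x)]
  · intro x hx
    rw [uIcc_of_le (by norm_num)] at hx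
    rw [mul_comm]
    exact hasDerivAt_evalAt (fun j => h.hasDerivAt j x hx) P
  · exact intervalIntegrable_mul_density h.cont (h.continuousOn_evalAt _)

lemma wint_arcDer_eq_zero (h : Profile v κ Λ) {P : MvPolynomial ℕ ℝ} {d : ℕ}
    (hP : HasWeight d P) (hd : Odd d) : wint v (evalAt κ (arcDer P)) = 0 := by
  rw [h.wint_arcDer, evalAt, evalAt, hP.eval_eq_zero hd fun j hj _ => (h.odd j hj).1,
    hP.eval_eq_zero hd fun j hj _ => (h.odd j hj).2, sub_zero]

lemma wint_sq_sq_le (h : Profile v κ Λ) (j : ℕ) :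
    wint v (fun x => κ (j + 1) x ^ 2) ^ 2 ≤
      wint v (fun x => κ j x ^ 2) * wint v (fun x => κ (j + 2) x ^ 2) := by
  have h1 := h.wint_arcDer_eq_zero ((HasWeight.X j).mul (HasWeight.X (j + 1)))
    ⟨j, by ring⟩
  have h2 : wint v (evalAt κ (arcDer (X j * X (j + 1)))) =
      wint v (fun x => κ j x * κ (j + 2) x + κ (j + 1) x ^ 2) :=
    wint_congr fun x _ => by simp [evalAt, Derivation.leibniz]; ring
  have c := h.continuousOn
  have c0 := c j
  have c1 := c (j + 1)
  have c2 := c (j + 2)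
  rw [h2, wint_add h.cont (by fun_prop) (by fun_prop)] at h1
  rw [eq_neg_of_add_eq_zero_right h1, neg_sq]
  exact wint_mul_sq_le h.cont h.pos c0 c2

lemma exists_eq_zero (h : Profile v κ Λ) (j : ℕ) : ∃ x ∈ Icc (-1:ℝ) 1, κ j x = 0 := by
  rcases Nat.even_or_odd j with hj | hj
  · refine exists_eq_zero_of_wint_eq_zero h.cont h.pos (h.continuousOn j) ?_
    rcases j with _ | j
    · exact h.mean
    · have := h.wint_arcDer_eq_zero (HasWeight.X j) (by grind)
      rw [arcDer_X] at this
      rw [← this]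
      exact wint_congr fun x _ => by simp [evalAt]
  · exact ⟨1, by simp, (h.odd j hj).2⟩

lemma abs_le (h : Profile v κ Λ) (j : ℕ) {a b : ℝ} (ha : 0 ≤ a) (hb : 0 ≤ b)
    (hlen : wint v (fun _ => 1) ≤ a ^ 2) (hS : wint v (fun x => κ (j + 1) x ^ 2) ≤ b ^ 2)
    {x : ℝ} (hx : x ∈ Icc (-1:ℝ) 1) : |κ j x| ≤ a * b := by
  obtain ⟨y, hy, hy0⟩ := h.exists_eq_zero j
  have hsub : uIcc y x ⊆ Icc (-1:ℝ) 1 := uIcc_subset_Icc hy hx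
  have c := h.continuousOn (j + 1)
  have hcont : ContinuousOn (fun u => κ (j + 1) u * v u) (Icc (-1) 1) := c.mul h.cont
  have hint : κ j x = ∫ u in y..x, κ (j + 1) u * v u := by
    rw [integral_eq_sub_of_hasDerivAt (f := κ j), hy0, sub_zero]
    · intro u hu
      rw [mul_comm]
      exact h.hasDerivAt j u (hsub hu)
    · exact (hcont.mono hsub).intervalIntegrable
  have hI : uIcc (-1:ℝ) 1 = Icc (-1) 1 := uIcc_of_le (by norm_num)
  have hle : |κ j x| ≤ |∫ u in (-1:ℝ)..1, |κ (j + 1) u| * v u| := by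
    rw [hint]
    refine (intervalIntegral.norm_integral_le_abs_integral_norm
      (f := fun u => κ (j + 1) u * v u)).trans ?_
    have e : ∀ s t : ℝ, s ∈ Icc (-1:ℝ) 1 → t ∈ Icc (-1:ℝ) 1 →
        ∫ u in s..t, ‖κ (j + 1) u * v u‖ = ∫ u in s..t, |κ (j + 1) u| * v u := fun s t hs ht =>
      integral_congr fun u hu => by
        simp [abs_of_pos (h.pos u (uIcc_subset_Icc hs ht hu))]
    rw [e y x hy hx]
    refine abs_integral_mono_interval ?_ ?_ ?_
    · rw [uIoc_of_le (by norm_num : (-1:ℝ) ≤ 1)]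
      exact Ioc_subset_Ioc (le_min hy.1 hx.1) (max_le hy.2 hx.2)
    · refine (ae_restrict_iff' measurableSet_uIoc).2 (ae_of_all _ fun u hu => ?_)
      exact mul_nonneg (abs_nonneg _) (h.pos u (hI ▸ uIoc_subset_uIcc hu)).le
    · exact (c.abs.mul h.cont).intervalIntegrable_of_Icc (by norm_num)
  refine hle.trans ?_
  have := wint_mul_le h.cont h.pos (f := fun u => |κ (j + 1) u|) (g := fun _ => 1) c.abs
    continuousOn_const hb ha (by simpa using hS) (by simpa using hlen)
  rw [mul_comm a b]
  simpa [wint] using this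

end Profile

/-- Bounds for the derivatives of curvature by powers of a parameter `Z`. -/
structure Controlled (v : ℝ → ℝ) (κ : ℕ → ℝ → ℝ) (n : ℕ) (A Z : ℝ) : Prop where
  one_le : 1 ≤ A
  one_le_param : 1 ≤ Z
  len : wint v (fun _ => 1) ≤ A ^ 2
  sup : ∀ j ≤ n + 4, ∀ x ∈ Icc (-1:ℝ) 1, |κ j x| ≤ A * Z ^ (j - n)
  sq : ∀ j ≤ n + 5, wint v (fun x => κ j x ^ 2) ≤ (A * Z ^ (j - (n + 1))) ^ 2

lemma Profile.controlled {v : ℝ → ℝ} {κ : ℕ → ℝ → ℝ} {Λ : ℝ} (h : Profile v κ Λ) {n : ℕ}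
    {K Z : ℝ} (hK : 1 ≤ K) (hZ : 1 ≤ Z) (hS : ∀ j ≤ n + 1, wint v (fun x => κ j x ^ 2) ≤ K ^ 2)
    (htop : wint v (fun x => κ (n + 5) x ^ 2) ≤ Z ^ 8) :
    Controlled v κ n ((1 + Λ) * K ^ 2) Z := by
  have hnn : ∀ j, 0 ≤ wint v (fun x => κ j x ^ 2) := fun j =>
    wint_nonneg h.pos fun x _ => sq_nonneg _
  have hΛ : 0 ≤ Λ := (wint_nonneg h.pos fun _ _ => zero_le_one).trans h.len
  have hK2 : K ≤ K ^ 2 := by nlinarith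
  have hK4 : K ^ 2 ≤ (K ^ 2) ^ 2 := by nlinarith
  have key : ∀ j ≤ n + 5, wint v (fun x => κ j x ^ 2) ≤ (K ^ 2 * Z ^ (j - (n + 1))) ^ 2 := by
    have i1 := h.wint_sq_sq_le (n + 1)
    have i2 := h.wint_sq_sq_le (n + 2)
    have i3 := h.wint_sq_sq_le (n + 3)
    simp only [add_assoc, Nat.reduceAdd] at i1 i2 i3
    have h0 := hS (n + 1) le_rfl
    have n1 := hnn (n + 1)
    have n2 := hnn (n + 2)
    have n3 := hnn (n + 3)
    have n4 := hnn (n + 4)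
    have n5 := hnn (n + 5)
    intro j hj
    have hlow : j ≤ n + 1 → wint v (fun x => κ j x ^ 2) ≤ (K ^ 2 * Z ^ (j - (n + 1))) ^ 2 :=
      fun hj => by
        rw [Nat.sub_eq_zero_of_le hj, pow_zero, mul_one]
        exact (hS j hj).trans hK4
    generalize wint v (fun x => κ (n + 1) x ^ 2) = S1 at *
    generalize e2 : wint v (fun x => κ (n + 2) x ^ 2) = S2 at *
    generalize e3 : wint v (fun x => κ (n + 3) x ^ 2) = S3 at *
    generalize e4 : wint v (fun x => κ (n + 4) x ^ 2) = S4 at *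
    generalize e5 : wint v (fun x => κ (n + 5) x ^ 2) = S5 at *
    have b3 : S3 ≤ K * Z ^ 4 := by
      have : S3 ^ 2 ≤ S1 * S5 := by
        rcases n3.eq_or_lt with h3 | h3
        · rw [← h3, zero_pow two_ne_zero]; exact mul_nonneg n1 n5
        · have h34 : (S3 ^ 2) ^ 2 ≤ S3 ^ 2 * (S1 * S5) := calc
            (S3 ^ 2) ^ 2 ≤ (S2 * S4) ^ 2 := pow_le_pow_left₀ (by positivity) i2 2
            _ = S2 ^ 2 * S4 ^ 2 := by ring
            _ ≤ (S1 * S3) * (S3 * S5) := mul_le_mul i1 i3 (by positivity) (by positivity)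
            _ = S3 ^ 2 * (S1 * S5) := by ring
          rw [pow_two (S3 ^ 2)] at h34
          exact le_of_mul_le_mul_left h34 (by positivity)
      refine (sq_le_sq₀ n3 (by positivity)).1 (this.trans ?_)
      calc S1 * S5 ≤ K ^ 2 * Z ^ 8 := mul_le_mul h0 htop n5 (by positivity)
        _ = (K * Z ^ 4) ^ 2 := by ring
    have b2 : S2 ≤ K ^ 2 * Z ^ 2 := by
      refine (sq_le_sq₀ n2 (by positivity)).1 (i1.trans ?_)
      calc S1 * S3 ≤ K ^ 2 * (K * Z ^ 4) := mul_le_mul h0 b3 n3 (by positivity)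
        _ ≤ K ^ 2 * (K ^ 2 * Z ^ 4) := by gcongr
        _ = (K ^ 2 * Z ^ 2) ^ 2 := by ring
    have b4 : S4 ≤ K * Z ^ 6 := by
      refine (sq_le_sq₀ n4 (by positivity)).1 (i3.trans ?_)
      calc S3 * S5 ≤ K * Z ^ 4 * Z ^ 8 := mul_le_mul b3 htop n5 (by positivity)
        _ ≤ K ^ 2 * Z ^ 4 * Z ^ 8 := by gcongr
        _ = (K * Z ^ 6) ^ 2 := by ring
    have hcase : j ≤ n + 1 ∨ j = n + 2 ∨ j = n + 3 ∨ j = n + 4 ∨ j = n + 5 := by omega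
    rcases hcase with hj' | rfl | rfl | rfl | rfl
    · exact hlow hj'
    · rw [show n + 2 - (n + 1) = 1 by omega, e2]
      calc S2 ≤ K ^ 2 * Z ^ 2 := b2
        _ ≤ (K ^ 2) ^ 2 * Z ^ 2 := by gcongr
        _ = _ := by ring
    · rw [show n + 3 - (n + 1) = 2 by omega, e3]
      calc S3 ≤ K * Z ^ 4 := b3
        _ ≤ (K ^ 2) ^ 2 * Z ^ 4 := by gcongr; exact hK2.trans hK4
        _ = _ := by ring
    · rw [show n + 4 - (n + 1) = 3 by omega, e4]
      calc S4 ≤ K * Z ^ 6 := b4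
        _ ≤ (K ^ 2) ^ 2 * Z ^ 6 := by gcongr; exact hK2.trans hK4
        _ = _ := by ring
    · rw [show n + 5 - (n + 1) = 4 by omega, e5]
      calc S5 ≤ 1 * Z ^ 8 := by simpa using htop
        _ ≤ (K ^ 2) ^ 2 * Z ^ 8 := by gcongr; exact hK.trans (hK2.trans hK4)
        _ = _ := by ring
  have hlen : wint v (fun _ => 1) ≤ (1 + Λ) ^ 2 := h.len.trans (by nlinarith)
  refine ⟨by nlinarith, hZ, hlen.trans ?_, fun j hj x hx => ?_, fun j hj => ?_⟩
  · gcongr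
    nlinarith
  · rw [mul_assoc, show j - n = j + 1 - (n + 1) by omega]
    exact h.abs_le j (by positivity) (by positivity) hlen (key (j + 1) (by omega)) hx
  · refine (key j hj).trans ?_
    gcongr
    nlinarith [sq_nonneg K]

lemma HasWeight.exists_bound {d : ℕ} {P : MvPolynomial ℕ ℝ} (hP : HasWeight d P) (n : ℕ)
    (A : ℝ) : ∃ B : ℝ, 0 ≤ B ∧ ∀ (v : ℝ → ℝ) (κ : ℕ → ℝ → ℝ) (Λ Z : ℝ), Profile v κ Λ →
      Controlled v κ n A Z →
      (d ≤ n + 4 → ∀ x ∈ Icc (-1:ℝ) 1, |evalAt κ P x| ≤ B * Z ^ (d - n)) ∧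
      (d ≤ n + 5 → wint v (fun x => evalAt κ P x ^ 2) ≤ (B * Z ^ (d - n)) ^ 2) := by
  induction hP with
  | const c =>
    refine ⟨|c| * |A|, by positivity, fun v κ Λ Z h hc => ⟨fun _ x _ => ?_, fun _ => ?_⟩⟩
    · have := le_abs_self A
      simpa [evalAt] using le_mul_of_one_le_right (abs_nonneg c) (hc.one_le.trans this)
    · have : wint v (fun x => evalAt κ (C c) x ^ 2) = c ^ 2 * wint v (fun _ => 1) := by
        rw [← wint_const_mul]; simp [evalAt]
      rw [this]
      simp only [Nat.zero_sub, pow_zero, mul_one, mul_pow, sq_abs]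
      exact mul_le_mul_of_nonneg_left hc.len (sq_nonneg c)
  | @add d P Q _ _ hP hQ =>
    obtain ⟨B₁, h₁, H₁⟩ := hP
    obtain ⟨B₂, h₂, H₂⟩ := hQ
    refine ⟨2 * (B₁ + B₂), by positivity, fun v κ Λ Z h hc => ⟨fun hd x hx => ?_, fun hd => ?_⟩⟩
    · have hz : 0 ≤ Z ^ (d - n) := pow_nonneg (zero_le_one.trans hc.one_le_param) _
      have e1 := (H₁ v κ Λ Z h hc).1 hd x hx
      have e2 := (H₂ v κ Λ Z h hc).1 hd x hx
      have : evalAt κ (P + Q) x = evalAt κ P x + evalAt κ Q x := by simp [evalAt]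
      rw [this]
      refine (abs_add_le _ _).trans ?_
      nlinarith [mul_nonneg h₁ hz, mul_nonneg h₂ hz]
    · have e1 := (H₁ v κ Λ Z h hc).2 hd
      have e2 := (H₂ v κ Λ Z h hc).2 hd
      have cP := h.continuousOn_evalAt P
      have cQ := h.continuousOn_evalAt Q
      have cPQ := h.continuousOn_evalAt (P + Q)
      have : wint v (fun x => evalAt κ (P + Q) x ^ 2) ≤
          wint v (fun x => 2 * evalAt κ P x ^ 2 + 2 * evalAt κ Q x ^ 2) :=
        wint_mono h.cont h.pos (by fun_prop) (by fun_prop) fun x _ => by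
          have : evalAt κ (P + Q) x = evalAt κ P x + evalAt κ Q x := by simp [evalAt]
          rw [this]
          nlinarith [sq_nonneg (evalAt κ P x - evalAt κ Q x)]
      rw [wint_add h.cont (by fun_prop) (by fun_prop), wint_const_mul, wint_const_mul] at this
      have hz : 0 ≤ (Z ^ (d - n)) ^ 2 := sq_nonneg _
      rw [mul_pow] at e1 e2 ⊢
      nlinarith [mul_nonneg (sq_nonneg B₁) hz, mul_nonneg (sq_nonneg B₂) hz,
        mul_nonneg (mul_nonneg h₁ h₂) hz]
  | @X_mul j d P _ hP =>
    obtain ⟨B, hB, H⟩ := hP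
    refine ⟨|A| * B, by positivity, fun v κ Λ Z h hc => ?_⟩
    have hZ := hc.one_le_param
    have hA : 0 ≤ A := zero_le_one.trans hc.one_le
    have he : ∀ x, evalAt κ (MvPolynomial.X j * P) x = κ j x * evalAt κ P x :=
      fun x => by simp [evalAt]
    have hpow : A * Z ^ (j - n) * (B * Z ^ (d - n)) ≤ A * B * Z ^ (j + d - n) := by
      calc A * Z ^ (j - n) * (B * Z ^ (d - n)) = A * B * Z ^ ((j - n) + (d - n)) := by
            rw [pow_add]; ring
        _ ≤ _ := by
          gcongr
          omega
    have hsq : 0 ≤ A * Z ^ (j - n) * (B * Z ^ (d - n)) := by positivity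
    have cj := h.continuousOn j
    have cP := h.continuousOn_evalAt P
    rw [abs_of_nonneg hA]
    simp only [he]
    refine ⟨fun hd x hx => ?_, fun hd => ?_⟩
    · rw [abs_mul]
      exact (mul_le_mul (hc.sup j (by omega) x hx) ((H v κ Λ Z h hc).1 (by omega) x hx)
        (abs_nonneg _) (by positivity)).trans hpow
    · refine le_trans ?_ (pow_le_pow_left₀ hsq hpow 2)
      rcases Nat.lt_or_ge (n + 4) j with hj | hj
      · obtain rfl : d = 0 := by omega
        calc wint v (fun x => (κ j x * evalAt κ P x) ^ 2)
            ≤ wint v (fun x => (B * Z ^ (0 - n)) ^ 2 * κ j x ^ 2) := by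
              refine wint_mono h.cont h.pos (by fun_prop) (by fun_prop) fun x hx => ?_
              rw [mul_pow, mul_comm]
              exact mul_le_mul_of_nonneg_right
                (sq_le_sq.2 (((H v κ Λ Z h hc).1 (by omega) x hx).trans (le_abs_self _)))
                (sq_nonneg _)
          _ ≤ (B * Z ^ (0 - n)) ^ 2 * (A * Z ^ (j - n)) ^ 2 := by
              rw [wint_const_mul]
              gcongr
              refine (hc.sq j (by omega)).trans ?_
              gcongr
              omega
          _ = _ := by ring
      · calc wint v (fun x => (κ j x * evalAt κ P x) ^ 2)
            ≤ wint v (fun x => (A * Z ^ (j - n)) ^ 2 * evalAt κ P x ^ 2) := by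
              refine wint_mono h.cont h.pos (by fun_prop) (by fun_prop) fun x hx => ?_
              rw [mul_pow]
              exact mul_le_mul_of_nonneg_right
                (sq_le_sq.2 ((hc.sup j hj x hx).trans (le_abs_self _))) (sq_nonneg _)
          _ ≤ (A * Z ^ (j - n)) ^ 2 * (B * Z ^ (d - n)) ^ 2 := by
              rw [wint_const_mul]
              gcongr
              exact (H v κ Λ Z h hc).2 (by omega)
          _ = _ := by ring
  | @lift d P _ hP =>
    obtain ⟨B, hB, H⟩ := hP
    refine ⟨B, hB, fun v κ Λ Z h hc => ?_⟩
    have hZ := hc.one_le_param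
    have hpow : B * Z ^ (d - n) ≤ B * Z ^ (d + 2 - n) := by
      gcongr
      omega
    refine ⟨fun hd x hx => ((H v κ Λ Z h hc).1 (by omega) x hx).trans hpow, fun hd => ?_⟩
    exact ((H v κ Λ Z h hc).2 (by omega)).trans (pow_le_pow_left₀ (by positivity) hpow 2)

/-- The integrand of the time derivative of `‖k_{s^m}‖₂²`. -/
def energyPoly (m : ℕ) : MvPolynomial ℕ ℝ :=
  2 * X m * evolPoly m - X m ^ 2 * X 0 * speedPoly

lemma hasWeight_speedPoly_mul : HasWeight 4 (X 0 * speedPoly) :=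
  ((HasWeight.X 0).mul hasWeight_speedPoly).of_eq (by ring) rfl

lemma Profile.wint_energyPoly_one_nonpos {v : ℝ → ℝ} {κ : ℕ → ℝ → ℝ} {Λ : ℝ}
    (h : Profile v κ Λ) : wint v (evalAt κ (energyPoly 1)) ≤ 0 := by
  have hw : HasWeight 7 (2 * X 1 * arcDer (arcDer speedPoly) - 2 * X 2 * arcDer speedPoly
      + 2 * X 3 * speedPoly + 2 * X 1 * X 0 ^ 2 * speedPoly) := by
    have hF := hasWeight_speedPoly
    refine ((((((HasWeight.X 1).mul hF.arcDer.arcDer).C_mul 2).sub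
      (((HasWeight.X 2).mul hF.arcDer).C_mul 2)).add (((HasWeight.X 3).mul hF).C_mul 2)).add
      (((HasWeight.X 1).mul ((HasWeight.X 0).mul ((HasWeight.X 0).mul hF))).lift.C_mul 2)).of_eq
      rfl ?_
    rw [show (C 2 : MvPolynomial ℕ ℝ) = 2 from rfl]
    ring
  have h0 := h.wint_arcDer_eq_zero hw (by decide)
  rw [energyPoly, energy_identity]
  set Q := 2 * X 1 * arcDer (arcDer speedPoly) - 2 * X 2 * arcDer speedPoly
      + 2 * X 3 * speedPoly + 2 * X 1 * X 0 ^ 2 * speedPoly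
  have cQ := h.continuousOn_evalAt (arcDer Q)
  have cF := h.continuousOn_evalAt speedPoly
  have e : wint v (evalAt κ (arcDer Q - 2 * speedPoly ^ 2)) =
      wint v (fun x => evalAt κ (arcDer Q) x - 2 * evalAt κ speedPoly x ^ 2) :=
    wint_congr fun x _ => by simp [evalAt]
  rw [e, wint_sub h.cont cQ (by fun_prop), wint_const_mul, h0]
  have := wint_nonneg (f := fun x => evalAt κ speedPoly x ^ 2) h.pos fun x _ => sq_nonneg _
  linarith

lemma Profile.wint_energyPoly {v : ℝ → ℝ} {κ : ℕ → ℝ → ℝ} {Λ : ℝ} (h : Profile v κ Λ)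
    (m : ℕ) : wint v (evalAt κ (energyPoly (m + 1))) =
      - 2 * wint v (fun x => κ (m + 4) x ^ 2)
      - 2 * wint v (fun x => κ (m + 2) x * evalAt κ (evolPoly m - X (m + 6)) x)
      + wint v (fun x => κ (m + 1) x * (κ (m + 1) x * evalAt κ (X 0 * speedPoly) x)) := by
  have hR := hasWeight_evolPoly_sub m
  set R := evolPoly m - X (m + 6) with hRdef
  have hw : HasWeight (2 * m + 7)
      (2 * (X (m + 1) * X (m + 6) - X (m + 2) * X (m + 5) + X (m + 3) * X (m + 4))
        + 2 * X (m + 1) * R) := by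
    refine ((((((HasWeight.X (m + 1)).mul (HasWeight.X (m + 6))).of_eq (by ring) rfl).sub
      (((HasWeight.X (m + 2)).mul (HasWeight.X (m + 5))).of_eq (by ring) rfl)).add
      (((HasWeight.X (m + 3)).mul (HasWeight.X (m + 4))).of_eq (by ring) rfl)).C_mul 2 |>.add
      ((((HasWeight.X (m + 1)).mul hR).lift.of_eq (by ring) rfl).C_mul 2)).of_eq
      rfl ?_
    rw [show (C 2 : MvPolynomial ℕ ℝ) = 2 from rfl]
    ring
  have h0 := h.wint_arcDer_eq_zero hw ⟨m + 3, by ring⟩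
  rw [energyPoly, higher_energy_identity, ← hRdef]
  set Q := 2 * (X (m + 1) * X (m + 6) - X (m + 2) * X (m + 5) + X (m + 3) * X (m + 4))
        + 2 * X (m + 1) * R
  have cQ := h.continuousOn_evalAt (arcDer Q)
  have cR := h.continuousOn_evalAt R
  have cF := h.continuousOn_evalAt (X 0 * speedPoly)
  have c1 := h.continuousOn (m + 1)
  have c2 := h.continuousOn (m + 2)
  have c4 := h.continuousOn (m + 4)
  have e : wint v (evalAt κ (arcDer Q - 2 * X (m + 4) ^ 2 - 2 * (X (m + 2) * R)
        + X (m + 1) * X (m + 1) * (X 0 * speedPoly))) =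
      wint v (fun x => evalAt κ (arcDer Q) x - 2 * κ (m + 4) x ^ 2
        - 2 * (κ (m + 2) x * evalAt κ R x)
        + κ (m + 1) x * (κ (m + 1) x * evalAt κ (X 0 * speedPoly) x)) :=
    wint_congr fun x _ => by simp [evalAt]; ring
  rw [e, wint_add h.cont (by fun_prop) (by fun_prop), wint_sub h.cont (by fun_prop) (by fun_prop),
    wint_sub h.cont (by fun_prop) (by fun_prop), wint_const_mul, wint_const_mul, h0]
  ring

theorem exists_dissipation (n : ℕ) (Λ K : ℝ) (hΛ : 0 ≤ Λ) (hK : 1 ≤ K) :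
    ∃ c M : ℝ, 0 < c ∧ 0 ≤ M ∧ ∀ (v : ℝ → ℝ) (κ : ℕ → ℝ → ℝ), Profile v κ Λ →
      (∀ j ≤ n + 1, wint v (fun x => κ j x ^ 2) ≤ K ^ 2) →
      wint v (evalAt κ (energyPoly (n + 2))) ≤ - c * wint v (fun x => κ (n + 2) x ^ 2) + M := by
  set A := (1 + Λ) * K ^ 2 with hA
  have hA1 : 1 ≤ A := by nlinarith
  obtain ⟨B, hB, HB⟩ := (hasWeight_evolPoly_sub (n + 1)).exists_bound n A
  obtain ⟨D, hD, HD⟩ := hasWeight_speedPoly_mul.exists_bound n A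
  set E := 2 * (A * B) + A * (A * D) with hE
  have hE0 : 0 ≤ E := by positivity
  refine ⟨(A ^ 2)⁻¹, 2 + E ^ 8, by positivity, by positivity, fun v κ h hS => ?_⟩
  have hnn : ∀ j, 0 ≤ wint v (fun x => κ j x ^ 2) := fun j =>
    wint_nonneg h.pos fun x _ => sq_nonneg _
  obtain ⟨Z, hZ1, hZ⟩ : ∃ Z : ℝ, 1 ≤ Z ∧ Z ^ 8 = 1 + wint v (fun x => κ (n + 5) x ^ 2) := by
    refine ⟨(1 + wint v (fun x => κ (n + 5) x ^ 2)) ^ ((8 : ℕ) : ℝ)⁻¹,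
      Real.one_le_rpow (by linarith [hnn (n + 5)]) (by positivity),
      Real.rpow_inv_natCast_pow (by linarith [hnn (n + 5)]) (by norm_num)⟩
  have hc : Controlled v κ n A Z := h.controlled hK hZ1 hS (by linarith)
  have hZ0 : 0 ≤ Z := zero_le_one.trans hZ1
  have s2 := hc.sq (n + 2) (by omega)
  have s3 := hc.sq (n + 3) (by omega)
  rw [show n + 2 - (n + 1) = 1 by omega, pow_one] at s2
  rw [show n + 3 - (n + 1) = 2 by omega] at s3
  have hR := (HB v κ Λ Z h hc).2 (by omega)
  rw [show n + 1 + 4 - n = 5 by omega] at hR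
  have c2 := h.continuousOn (n + 2)
  have c3 := h.continuousOn (n + 3)
  have cR := h.continuousOn_evalAt (evolPoly (n + 1) - X (n + 1 + 6))
  have cF := h.continuousOn_evalAt (X 0 * speedPoly)
  have t1 := wint_mul_le h.cont h.pos c3 cR (a := A * Z ^ 2) (b := B * Z ^ 5) (by positivity)
    (by positivity) s3 hR
  have t2 := wint_mul_le h.cont h.pos c2 (c2.mul cF) (a := A * Z) (b := (D * Z ^ 4) * (A * Z))
    (by positivity) (by positivity) s2 (by
      calc wint v (fun x => (κ (n + 2) x * evalAt κ (X 0 * speedPoly) x) ^ 2)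
          ≤ wint v (fun x => (D * Z ^ 4) ^ 2 * κ (n + 2) x ^ 2) := by
            refine wint_mono h.cont h.pos (by fun_prop) (by fun_prop) fun x hx => ?_
            rw [mul_pow, mul_comm]
            refine mul_le_mul_of_nonneg_right (sq_le_sq.2 ?_) (sq_nonneg _)
            refine ((HD v κ Λ Z h hc).1 (by omega) x hx).trans (le_trans ?_ (le_abs_self _))
            gcongr
            omega
        _ ≤ (D * Z ^ 4) ^ 2 * (A * Z) ^ 2 := by
            rw [wint_const_mul]
            gcongr
        _ = _ := by ring)
  rw [h.wint_energyPoly (n + 1)]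
  simp only [add_assoc, Nat.reduceAdd] at t1 t2 ⊢
  have hE7 : 2 * (A * Z ^ 2 * (B * Z ^ 5)) + A * Z * (D * Z ^ 4 * (A * Z)) ≤ E * Z ^ 7 := by
    have h67 : Z ^ 6 ≤ Z ^ 7 := pow_le_pow_right₀ hZ1 (by norm_num)
    have := mul_le_mul_of_nonneg_left h67 (show 0 ≤ A * (A * D) by positivity)
    rw [hE]; linarith
  have hE8 : E * Z ^ 7 ≤ Z ^ 8 + E ^ 8 := by
    rcases le_total E Z with hle | hle
    · have : E * Z ^ 7 ≤ Z * Z ^ 7 := by gcongr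
      linarith [pow_nonneg hE0 8, pow_succ' Z 7]
    · have : E * Z ^ 7 ≤ E * E ^ 7 := by gcongr
      linarith [pow_nonneg hZ0 8, pow_succ' E 7]
  have hlow : (A ^ 2)⁻¹ * wint v (fun x => κ (n + 2) x ^ 2) ≤ Z ^ 8 := by
    rw [inv_mul_le_iff₀ (by positivity)]
    calc _ ≤ A ^ 2 * Z ^ 2 := by rw [← mul_pow]; exact s2
      _ ≤ A ^ 2 * Z ^ 8 := by
        gcongr
        norm_num
  have l1 := (abs_le.1 t1).1
  have l2 := (abs_le.1 t2).2
  simp only [Pi.mul_apply] at l2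
  clear_value A E
  clear hE hA s2 s3 hR t1 t2
  linarith

lemma Profile.wint_zero_sq_le {v : ℝ → ℝ} {κ : ℕ → ℝ → ℝ} {Λ : ℝ} (h : Profile v κ Λ) {b : ℝ}
    (hb : 0 ≤ b) (hS : wint v (fun x => κ 1 x ^ 2) ≤ b ^ 2) :
    wint v (fun x => κ 0 x ^ 2) ≤ ((1 + Λ) * b) ^ 2 * Λ := by
  have hΛ : 0 ≤ Λ := (wint_nonneg h.pos fun _ _ => zero_le_one).trans h.len
  have c0 := h.continuousOn 0
  have hsup := fun x hx => h.abs_le 0 (a := 1 + Λ) (by positivity) hb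
    (h.len.trans (by nlinarith)) hS (x := x) hx
  calc wint v (fun x => κ 0 x ^ 2) ≤ wint v (fun x => ((1 + Λ) * b) ^ 2 * 1) :=
        wint_mono h.cont h.pos (by fun_prop) (by fun_prop) fun x hx => by
          rw [mul_one]
          exact sq_le_sq.2 ((hsup x hx).trans (le_abs_self _))
    _ ≤ _ := by
      rw [wint_const_mul]
      exact mul_le_mul_of_nonneg_left h.len (sq_nonneg _)

end Profiles
section Smoothness

variable {E : Type*} [NormedAddCommGroup E] [NormedSpace ℝ E]

/-- Smoothness of a function of time and space at the points of `U`. -/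
def SmoothAtPoints (U : Set (ℝ × ℝ)) (f : ℝ → ℝ → E) : Prop :=
  ∀ p ∈ U, ContDiffAt ℝ (⊤ : ℕ∞) (Function.uncurry f) p

namespace SmoothAtPoints

variable {U : Set (ℝ × ℝ)} {f : ℝ → ℝ → E} {t x : ℝ}

lemma congr {g : ℝ → ℝ → E} (hU : IsOpen U) (hf : SmoothAtPoints U f)
    (h : ∀ t x, (t, x) ∈ U → g t x = f t x) : SmoothAtPoints U g := fun p hp =>
  (hf p hp).congr_of_eventuallyEq <| by
    filter_upwards [hU.mem_nhds hp] with q hq using h q.1 q.2 hq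

lemma hasFDerivAt (hf : SmoothAtPoints U f) (h : (t, x) ∈ U) :
    HasFDerivAt (Function.uncurry f) (fderiv ℝ (Function.uncurry f) (t, x)) (t, x) :=
  ((hf _ h).differentiableAt (by simp)).hasFDerivAt

lemma hasDerivAt_space_fderiv (hf : SmoothAtPoints U f) (h : (t, x) ∈ U) :
    HasDerivAt (f t) (fderiv ℝ (Function.uncurry f) (t, x) (0, 1)) x :=
  (hf.hasFDerivAt h).comp_hasDerivAt (f := fun y => (t, y)) x
    ((hasDerivAt_const x t).prodMk (hasDerivAt_id x))

lemma hasDerivAt_time_fderiv (hf : SmoothAtPoints U f) (h : (t, x) ∈ U) :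
    HasDerivAt (fun u => f u x) (fderiv ℝ (Function.uncurry f) (t, x) (1, 0)) t :=
  (hf.hasFDerivAt h).comp_hasDerivAt (f := fun u => (u, x)) t
    ((hasDerivAt_id t).prodMk (hasDerivAt_const t x))

lemma hasDerivAt_space (hf : SmoothAtPoints U f) (h : (t, x) ∈ U) :
    HasDerivAt (f t) (deriv (f t) x) x :=
  (hf.hasDerivAt_space_fderiv h).differentiableAt.hasDerivAt

lemma hasDerivAt_time (hf : SmoothAtPoints U f) (h : (t, x) ∈ U) :
    HasDerivAt (fun u => f u x) (deriv (fun u => f u x) t) t :=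
  (hf.hasDerivAt_time_fderiv h).differentiableAt.hasDerivAt

lemma fderiv_apply (hf : SmoothAtPoints U f) (w : ℝ × ℝ) :
    SmoothAtPoints U fun t x => fderiv ℝ (Function.uncurry f) (t, x) w := fun p hp =>
  ((hf p hp).fderiv_right (m := (⊤ : ℕ∞)) (by simp)).clm_apply contDiffAt_const

lemma space_deriv (hU : IsOpen U) (hf : SmoothAtPoints U f) :
    SmoothAtPoints U fun t x => deriv (f t) x :=
  (hf.fderiv_apply (0, 1)).congr hU fun _ _ h => (hf.hasDerivAt_space_fderiv h).deriv

lemma time_deriv (hU : IsOpen U) (hf : SmoothAtPoints U f) :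
    SmoothAtPoints U fun t x => deriv (fun u => f u x) t :=
  (hf.fderiv_apply (1, 0)).congr hU fun _ _ h => (hf.hasDerivAt_time_fderiv h).deriv

lemma deriv_comm (hU : IsOpen U) (hf : SmoothAtPoints U f) (h : (t, x) ∈ U) :
    deriv (fun u => deriv (f u) x) t = deriv (fun y => deriv (fun u => f u y) t) x := by
  have e1 : deriv (fun u => deriv (f u) x) t =
      deriv (fun u => fderiv ℝ (Function.uncurry f) (u, x) (0, 1)) t := by
    refine Filter.EventuallyEq.deriv_eq ?_
    have hc : ContinuousAt (fun u : ℝ => (u, x)) t := by fun_prop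
    filter_upwards [hc (hU.mem_nhds h)] with u hu
    exact (hf.hasDerivAt_space_fderiv hu).deriv
  have e2 : deriv (fun y => deriv (fun u => f u y) t) x =
      deriv (fun y => fderiv ℝ (Function.uncurry f) (t, y) (1, 0)) x := by
    refine Filter.EventuallyEq.deriv_eq ?_
    have hc : ContinuousAt (fun y : ℝ => (t, y)) x := by fun_prop
    filter_upwards [hc (hU.mem_nhds h)] with y hy
    exact (hf.hasDerivAt_time_fderiv hy).deriv
  have hd : HasFDerivAt (fderiv ℝ (Function.uncurry f))
      (fderiv ℝ (fderiv ℝ (Function.uncurry f)) (t, x)) (t, x) :=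
    (((hf _ h).fderiv_right (m := (⊤ : ℕ∞)) (by simp)).differentiableAt (by simp)).hasFDerivAt
  have d1 := (hd.comp_hasDerivAt (f := fun u => (u, x)) t
    ((hasDerivAt_id t).prodMk (hasDerivAt_const t x))).clm_apply
    (hasDerivAt_const t ((0 : ℝ), (1 : ℝ)))
  have d2 := (hd.comp_hasDerivAt (f := fun y => (t, y)) x
    ((hasDerivAt_const x t).prodMk (hasDerivAt_id x))).clm_apply
    (hasDerivAt_const x ((1 : ℝ), (0 : ℝ)))
  have d1' := d1.deriv
  have d2' := d2.deriv
  simp only [Function.comp_def, map_zero, add_zero] at d1' d2'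
  rw [e1, e2, d1', d2']
  exact (hf _ h).isSymmSndFDerivAt
    (by
      rw [minSmoothness_of_isRCLikeNormedField]
      exact WithTop.coe_le_coe.2 (le_top : (2 : ℕ∞) ≤ ⊤)) _ _

lemma continuousOn (hf : SmoothAtPoints U f) : ContinuousOn (Function.uncurry f) U :=
  fun p hp => (hf p hp).continuousAt.continuousWithinAt

end SmoothAtPoints

lemma hasDerivAt_integral_of_smoothAtPoints {U : Set (ℝ × ℝ)} (hU : IsOpen U) {f : ℝ → ℝ → ℝ}
    (hf : SmoothAtPoints U f) {t a b : ℝ} (hab : a ≤ b) (h : ∀ x ∈ Icc a b, (t, x) ∈ U) :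
    HasDerivAt (fun u => ∫ x in a..b, f u x)
      (∫ x in a..b, deriv (fun u => f u x) t) t := by
  have hev : ∀ᶠ u in nhds t, ∀ x ∈ Icc a b, (u, x) ∈ U :=
    isCompact_Icc.eventually_forall_of_forall_eventually fun x hx => hU.mem_nhds (h x hx)
  obtain ⟨ε, hε, hball⟩ := Metric.nhds_basis_closedBall.eventually_iff.1 hev
  have hsub : Metric.closedBall t ε ×ˢ Icc a b ⊆ U := fun p hp => hball hp.1 p.2 hp.2
  have hft := hf.time_deriv hU
  obtain ⟨M, hM⟩ := ((isCompact_closedBall t ε).prod isCompact_Icc).exists_bound_of_continuousOn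
    (hft.continuousOn.mono hsub)
  have hslice : ∀ g : ℝ → ℝ → ℝ, SmoothAtPoints U g → ∀ u ∈ Metric.closedBall t ε,
      IntervalIntegrable (g u) volume a b := fun g hg u hu =>
    ContinuousOn.intervalIntegrable_of_Icc hab fun x hx =>
      (hg.hasDerivAt_space (hball hu x hx)).continuousAt.continuousWithinAt
  have hmem : Metric.closedBall t ε ∈ nhds t := Metric.closedBall_mem_nhds t hε
  have huI : ∀ x ∈ uIoc a b, x ∈ Icc a b := fun x hx => by
    rw [uIoc_of_le hab] at hx; exact Ioc_subset_Icc_self hx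
  refine (intervalIntegral.hasDerivAt_integral_of_dominated_loc_of_deriv_le
    (F := f) (F' := fun u x => deriv (fun u => f u x) u) (bound := fun _ => M) hmem
    ?_ (hslice f hf t (mem_of_mem_nhds hmem)) ?_ ?_ (by simp) ?_).2
  · filter_upwards [hmem] with u hu
    exact (intervalIntegrable_iff.1 (hslice f hf u hu)).aestronglyMeasurable
  · exact (intervalIntegrable_iff.1 (hslice _ hft t (mem_of_mem_nhds hmem))).aestronglyMeasurable
  · exact ae_of_all _ fun x hx u hu => hM (u, x) ⟨hu, huI x hx⟩
  · exact ae_of_all _ fun x hx u hu => hf.hasDerivAt_time (hball hu x (huI x hx))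

lemma HasDerivAt.unique_of_eqOn_Icc {f g : ℝ → ℝ} {f' g' a b x : ℝ} (hab : a < b)
    (hf : HasDerivAt f f' x) (hg : HasDerivAt g g' x) (hx : x ∈ Icc a b)
    (h : ∀ y ∈ Icc a b, f y = g y) : f' = g' :=
  (uniqueDiffOn_Icc hab x hx).eq_deriv _ hf.hasDerivWithinAt
    (hg.hasDerivWithinAt.congr h (h x hx))

lemma le_add_div_of_deriv_le {f f' : ℝ → ℝ} {c M t : ℝ} (hc : 0 < c) (hM : 0 ≤ M) (ht : 0 ≤ t)
    (hcont : ∀ u ∈ Icc 0 t, ContinuousAt f u) (hf0 : 0 ≤ f 0)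
    (hder : ∀ u ∈ Ioo 0 t, HasDerivAt f (f' u) u) (hle : ∀ u ∈ Ioo 0 t, f' u ≤ -c * f u + M) :
    f t ≤ f 0 + M / c := by
  have hd : ∀ u ∈ Ioo 0 t, HasDerivAt (fun u => (f u - M / c) * Real.exp (c * u))
      ((f' u + c * f u - M) * Real.exp (c * u)) u := fun u hu => by
    have h1 := (hder u hu).sub_const (M / c)
    have h2 : HasDerivAt (fun u : ℝ => Real.exp (c * u)) (Real.exp (c * u) * c) u := by
      simpa using ((hasDerivAt_id u).const_mul c).exp
    refine (h1.fun_mul h2).congr_deriv ?_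
    field_simp
    ring
  have hanti : AntitoneOn (fun u => (f u - M / c) * Real.exp (c * u)) (Icc 0 t) := by
    refine antitoneOn_of_deriv_nonpos (convex_Icc 0 t) (fun u hu => ?_) (fun u hu => ?_)
      fun u hu => ?_
    · have := hcont u hu
      exact ContinuousAt.continuousWithinAt (by fun_prop)
    · rw [interior_Icc] at hu
      exact (hd u hu).differentiableAt.differentiableWithinAt
    · rw [interior_Icc] at hu
      rw [(hd u hu).deriv]
      exact mul_nonpos_of_nonpos_of_nonneg (by linarith [hle u hu]) (Real.exp_pos _).le
  have h := hanti (left_mem_Icc.2 ht) (right_mem_Icc.2 ht) ht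
  simp only [mul_zero, Real.exp_zero, mul_one] at h
  have he : 1 ≤ Real.exp (c * t) := Real.one_le_exp (by positivity)
  have hMc : 0 ≤ M / c := by positivity
  by_contra! hlt
  nlinarith

end Smoothness

section ArcLength

variable {γ : ℝ → ℝ → E2}

/-- The points at which the parametrization is regular. -/
def regularPoints (γ : ℝ → ℝ → E2) : Set (ℝ × ℝ) := {p | deriv (γ p.1) p.2 ≠ 0}

/-- The components of the unit tangent. -/
def tangentComp (γ : ℝ → ℝ → E2) (i : Fin 2) (t x : ℝ) : ℝ :=
  aderiv (γ t) (fun y => γ t y i) x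

lemma smoothAtPoints_univ (hγ : ContDiff ℝ (⊤ : ℕ∞) (Function.uncurry γ)) :
    SmoothAtPoints univ γ := fun _ _ => hγ.contDiffAt

lemma isOpen_regularPoints (hγ : ContDiff ℝ (⊤ : ℕ∞) (Function.uncurry γ)) :
    IsOpen (regularPoints γ) := by
  have := ((smoothAtPoints_univ hγ).space_deriv isOpen_univ).continuousOn
  rw [continuousOn_univ] at this
  exact isOpen_ne_fun this continuous_const

lemma smoothAtPoints_comp (hγ : ContDiff ℝ (⊤ : ℕ∞) (Function.uncurry γ)) (U : Set (ℝ × ℝ))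
    (i : Fin 2) : SmoothAtPoints U fun t x => γ t x i := fun _ _ =>
  ((EuclideanSpace.proj (𝕜 := ℝ) i).contDiff.comp hγ).contDiffAt

lemma smoothAtPoints_speed (hγ : ContDiff ℝ (⊤ : ℕ∞) (Function.uncurry γ)) :
    SmoothAtPoints (regularPoints γ) fun t x => ‖deriv (γ t) x‖ := fun p hp =>
  ContDiffAt.norm ℝ ((smoothAtPoints_univ hγ).space_deriv isOpen_univ p (mem_univ _)) hp

lemma SmoothAtPoints.aderiv (hγ : ContDiff ℝ (⊤ : ℕ∞) (Function.uncurry γ)) {f : ℝ → ℝ → ℝ}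
    (hf : SmoothAtPoints (regularPoints γ) f) :
    SmoothAtPoints (regularPoints γ) fun t x => aderiv (γ t) (f t) x := fun p hp =>
  ((smoothAtPoints_speed hγ p hp).inv (norm_ne_zero_iff.2 hp)).mul
    (hf.space_deriv (isOpen_regularPoints hγ) p hp)

lemma SmoothAtPoints.hasDerivAt_aderiv {f : ℝ → ℝ → ℝ}
    (hf : SmoothAtPoints (regularPoints γ) f) {t x : ℝ} (h : (t, x) ∈ regularPoints γ) :
    HasDerivAt (f t) (‖deriv (γ t) x‖ * _root_.aderiv (γ t) (f t) x) x := by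
  have : ‖deriv (γ t) x‖ ≠ 0 := norm_ne_zero_iff.2 h
  rw [_root_.aderiv, mul_inv_cancel_left₀ this]
  exact hf.hasDerivAt_space h

lemma hasDerivAt_component {f : ℝ → E2} {f' : E2} {x : ℝ} (h : HasDerivAt f f' x) (i : Fin 2) :
    HasDerivAt (fun y => f y i) (f' i) x :=
  (EuclideanSpace.proj (𝕜 := ℝ) i).hasFDerivAt.comp_hasDerivAt x h

lemma utangent_apply (hγ : ContDiff ℝ (⊤ : ℕ∞) (Function.uncurry γ)) (i : Fin 2) (t x : ℝ) :
    utangent (γ t) x i = tangentComp γ i t x := by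
  have := (hasDerivAt_component ((smoothAtPoints_univ hγ).hasDerivAt_space
    (mem_univ (t, x))) i).deriv
  simp [utangent, aderivVec, tangentComp, aderiv, this]

lemma unormal_apply_zero (hγ : ContDiff ℝ (⊤ : ℕ∞) (Function.uncurry γ)) (t x : ℝ) :
    unormal (γ t) x 0 = -tangentComp γ 1 t x := by
  simp [unormal, rot, utangent_apply hγ]

lemma unormal_apply_one (hγ : ContDiff ℝ (⊤ : ℕ∞) (Function.uncurry γ)) (t x : ℝ) :
    unormal (γ t) x 1 = tangentComp γ 0 t x := by
  simp [unormal, rot, utangent_apply hγ]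

lemma smoothAtPoints_tangentComp (hγ : ContDiff ℝ (⊤ : ℕ∞) (Function.uncurry γ)) (i : Fin 2) :
    SmoothAtPoints (regularPoints γ) (tangentComp γ i) :=
  (smoothAtPoints_comp hγ _ i).aderiv hγ

lemma tangentComp_sq_add_sq (hγ : ContDiff ℝ (⊤ : ℕ∞) (Function.uncurry γ)) {t x : ℝ}
    (h : (t, x) ∈ regularPoints γ) :
    tangentComp γ 0 t x ^ 2 + tangentComp γ 1 t x ^ 2 = 1 := by
  have hn : ‖utangent (γ t) x‖ = 1 := by
    have : ‖deriv (γ t) x‖ ≠ 0 := norm_ne_zero_iff.2 h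
    rw [utangent, aderivVec, norm_smul, norm_inv, norm_norm, inv_mul_cancel₀ this]
  have := EuclideanSpace.norm_sq_eq (utangent (γ t) x)
  simpa [hn, utangent_apply hγ, Fin.sum_univ_two] using this.symm

lemma curv_eq (hγ : ContDiff ℝ (⊤ : ℕ∞) (Function.uncurry γ)) {t x : ℝ}
    (h : (t, x) ∈ regularPoints γ) :
    curv (γ t) x = tangentComp γ 0 t x * aderiv (γ t) (tangentComp γ 1 t) x
      - tangentComp γ 1 t x * aderiv (γ t) (tangentComp γ 0 t) x := by
  have hd : DifferentiableAt ℝ (utangent (γ t)) x := by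
    rw [differentiableAt_euclidean]
    intro i
    simp only [utangent_apply hγ]
    exact ((smoothAtPoints_tangentComp hγ i).hasDerivAt_space h).differentiableAt
  have hc : ∀ i, aderivVec (γ t) (utangent (γ t)) x i = aderiv (γ t) (tangentComp γ i t) x :=
    fun i => by
      have := (hasDerivAt_component hd.hasDerivAt i).deriv
      simp only [utangent_apply hγ] at this
      simp [aderivVec, aderiv, ← this]
  rw [curv, PiLp.inner_apply]
  simp [Fin.sum_univ_two, hc, unormal_apply_zero hγ, unormal_apply_one hγ]
  ring

lemma smoothAtPoints_kds (hγ : ContDiff ℝ (⊤ : ℕ∞) (Function.uncurry γ)) (j : ℕ) :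
    SmoothAtPoints (regularPoints γ) fun t x => kds (γ t) j x := by
  induction j with
  | zero =>
    have hs := smoothAtPoints_tangentComp hγ
    refine SmoothAtPoints.congr (isOpen_regularPoints hγ)
      (f := fun t x => tangentComp γ 0 t x * aderiv (γ t) (tangentComp γ 1 t) x
        - tangentComp γ 1 t x * aderiv (γ t) (tangentComp γ 0 t) x) (fun p hp => ?_)
      fun t x h => curv_eq hγ h
    exact ((hs 0 p hp).mul ((hs 1).aderiv hγ p hp)).sub
      ((hs 1 p hp).mul ((hs 0).aderiv hγ p hp))
  | succ j ih => exact ih.aderiv hγ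

lemma hasDerivAt_kds (hγ : ContDiff ℝ (⊤ : ℕ∞) (Function.uncurry γ)) {t x : ℝ}
    (h : (t, x) ∈ regularPoints γ) (j : ℕ) :
    HasDerivAt (kds (γ t) j) (‖deriv (γ t) x‖ * kds (γ t) (j + 1) x) x :=
  (smoothAtPoints_kds hγ j).hasDerivAt_aderiv h

lemma aderiv_tangentComp (hγ : ContDiff ℝ (⊤ : ℕ∞) (Function.uncurry γ)) {t x : ℝ}
    (h : (t, x) ∈ regularPoints γ) :
    aderiv (γ t) (tangentComp γ 0 t) x = -(curv (γ t) x * tangentComp γ 1 t x) ∧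
      aderiv (γ t) (tangentComp γ 1 t) x = curv (γ t) x * tangentComp γ 0 t x := by
  have hs := smoothAtPoints_tangentComp hγ
  have d := (((hs 0).hasDerivAt_aderiv h).fun_pow 2).fun_add
    (((hs 1).hasDerivAt_aderiv h).fun_pow 2)
  have d' := d.congr_of_eventuallyEq (f₁ := fun _ => (1 : ℝ)) <| by
    have hc : ContinuousAt (fun y : ℝ => (t, y)) x := by fun_prop
    filter_upwards [hc ((isOpen_regularPoints hγ).mem_nhds h)] with y hy
    exact (tangentComp_sq_add_sq hγ hy).symm
  have e := d'.unique (hasDerivAt_const x 1)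
  have hv : ‖deriv (γ t) x‖ ≠ 0 := norm_ne_zero_iff.2 h
  have e' : tangentComp γ 0 t x * aderiv (γ t) (tangentComp γ 0 t) x
      + tangentComp γ 1 t x * aderiv (γ t) (tangentComp γ 1 t) x = 0 := by
    refine (mul_eq_zero_iff_left (mul_ne_zero two_ne_zero hv)).1 ?_
    push_cast at e
    linear_combination e
  have n := tangentComp_sq_add_sq hγ h
  rw [curv_eq hγ h]
  constructor
  · linear_combination tangentComp γ 0 t x * e' - aderiv (γ t) (tangentComp γ 0 t) x * n
  · linear_combination tangentComp γ 1 t x * e' - aderiv (γ t) (tangentComp γ 1 t) x * n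

end ArcLength
section Dynamics

open MvPolynomial

/-- The positive times of existence. -/
def positiveTimes (T : ℝ≥0∞) : Set ℝ := {t | 0 < t ∧ ENNReal.ofReal t < T}

lemma isOpen_positiveTimes (T : ℝ≥0∞) : IsOpen (positiveTimes T) :=
  isOpen_Ioi.inter (isOpen_lt ENNReal.continuous_ofReal continuous_const)

lemma inTime_of_mem_positiveTimes {T : ℝ≥0∞} {t : ℝ} (h : t ∈ positiveTimes T) : inTime T t :=
  ⟨h.1.le, h.2⟩

/-- The logarithmic time derivative of the parametrization speed. -/
def logSpeedDeriv (γ : ℝ → ℝ → E2) (t x : ℝ) : ℝ :=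
  deriv (fun u => ‖deriv (γ u) x‖) t / ‖deriv (γ t) x‖

lemma hasDerivAt_time_aderiv {γ : ℝ → ℝ → E2} (hγ : ContDiff ℝ (⊤ : ℕ∞) (Function.uncurry γ))
    {f : ℝ → ℝ → ℝ} (hf : SmoothAtPoints (regularPoints γ) f) {t x a b g' : ℝ} {g : ℝ → ℝ}
    (hab : a < b) (hx : x ∈ Icc a b) (h : (t, x) ∈ regularPoints γ)
    (hg : ∀ y ∈ Icc a b, deriv (fun u => f u y) t = g y)
    (hg' : HasDerivAt g (‖deriv (γ t) x‖ * g') x) :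
    HasDerivAt (fun u => aderiv (γ u) (f u) x)
      (g' - logSpeedDeriv γ t x * aderiv (γ t) (f t) x) t := by
  have hU := isOpen_regularPoints hγ
  have hv : ‖deriv (γ t) x‖ ≠ 0 := norm_ne_zero_iff.2 h
  have hs := (smoothAtPoints_speed hγ).hasDerivAt_time h
  have hd := (hf.space_deriv hU).hasDerivAt_time h
  rw [hf.deriv_comm hU h, HasDerivAt.unique_of_eqOn_Icc hab ((hf.time_deriv hU).hasDerivAt_space h)
    hg' hx hg] at hd
  refine ((hs.fun_inv hv).fun_mul hd).congr_deriv ?_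
  rw [aderiv, logSpeedDeriv]
  field_simp
  ring

namespace SixthFlow

variable {T : ℝ≥0∞} (Φ : SixthFlow T) {t x : ℝ}

lemma mem_regularPoints (ht : inTime T t) (hx : x ∈ Icc (-1 : ℝ) 1) :
    (t, x) ∈ regularPoints Φ.γ := Φ.regular ht hx

lemma speedF_eq (t x : ℝ) : speedF (Φ.γ t) x = evalAt (kds (Φ.γ t)) speedPoly x := by
  simp [speedF, evalAt, speedPoly, kds, aderivIter]

lemma hasDerivAt_evalAt (ht : inTime T t) (hx : x ∈ Icc (-1 : ℝ) 1) (P : MvPolynomial ℕ ℝ) :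
    HasDerivAt (evalAt (kds (Φ.γ t)) P)
      (‖deriv (Φ.γ t) x‖ * evalAt (kds (Φ.γ t)) (arcDer P) x) x :=
  _root_.hasDerivAt_evalAt (v := fun x => ‖deriv (Φ.γ t) x‖)
    (fun j => hasDerivAt_kds Φ.smooth (Φ.mem_regularPoints ht hx) j) P

lemma hasDerivAt_tangentComp (ht : inTime T t) (hx : x ∈ Icc (-1 : ℝ) 1) :
    HasDerivAt (tangentComp Φ.γ 0 t)
        (‖deriv (Φ.γ t) x‖ * -(curv (Φ.γ t) x * tangentComp Φ.γ 1 t x)) x ∧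
      HasDerivAt (tangentComp Φ.γ 1 t)
        (‖deriv (Φ.γ t) x‖ * (curv (Φ.γ t) x * tangentComp Φ.γ 0 t x)) x := by
  have h := Φ.mem_regularPoints ht hx
  have hs := smoothAtPoints_tangentComp Φ.smooth
  have e := aderiv_tangentComp Φ.smooth h
  rw [← e.1, ← e.2]
  exact ⟨(hs 0).hasDerivAt_aderiv h, (hs 1).hasDerivAt_aderiv h⟩

lemma hasDerivAt_time_comp (ht : t ∈ positiveTimes T) (hx : x ∈ Icc (-1 : ℝ) 1) :
    HasDerivAt (fun u => Φ.γ u x 0)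
        (-(evalAt (kds (Φ.γ t)) speedPoly x * tangentComp Φ.γ 1 t x)) t ∧
      HasDerivAt (fun u => Φ.γ u x 1)
        (evalAt (kds (Φ.γ t)) speedPoly x * tangentComp Φ.γ 0 t x) t := by
  have h := (Φ.flow (inTime_of_mem_positiveTimes ht) hx).hasDerivAt (Ici_mem_nhds ht.1)
  have h0 := hasDerivAt_component h 0
  have h1 := hasDerivAt_component h 1
  simp only [PiLp.smul_apply, smul_eq_mul, unormal_apply_zero Φ.smooth,
    unormal_apply_one Φ.smooth, Φ.speedF_eq, mul_neg] at h0 h1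
  exact ⟨h0, h1⟩

lemma hasDerivAt_time_tangentComp_aux (ht : t ∈ positiveTimes T) (hx : x ∈ Icc (-1 : ℝ) 1) :
    HasDerivAt (fun u => tangentComp Φ.γ 0 u x)
        (-(evalAt (kds (Φ.γ t)) (arcDer speedPoly) x * tangentComp Φ.γ 1 t x
          + evalAt (kds (Φ.γ t)) speedPoly x * (curv (Φ.γ t) x * tangentComp Φ.γ 0 t x))
          - logSpeedDeriv Φ.γ t x * tangentComp Φ.γ 0 t x) t ∧
      HasDerivAt (fun u => tangentComp Φ.γ 1 u x)
        (evalAt (kds (Φ.γ t)) (arcDer speedPoly) x * tangentComp Φ.γ 0 t x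
          - evalAt (kds (Φ.γ t)) speedPoly x * (curv (Φ.γ t) x * tangentComp Φ.γ 1 t x)
          - logSpeedDeriv Φ.γ t x * tangentComp Φ.γ 1 t x) t := by
  have ht' := inTime_of_mem_positiveTimes ht
  have h := Φ.mem_regularPoints ht' hx
  have hF := Φ.hasDerivAt_evalAt ht' hx speedPoly
  have hT := Φ.hasDerivAt_tangentComp ht' hx
  constructor
  · refine hasDerivAt_time_aderiv Φ.smooth (smoothAtPoints_comp Φ.smooth _ 0) (by norm_num) hx h
      (fun y hy => (Φ.hasDerivAt_time_comp ht hy).1.deriv) ?_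
    refine (hF.fun_mul hT.2).fun_neg.congr_deriv ?_
    ring
  · refine hasDerivAt_time_aderiv Φ.smooth (smoothAtPoints_comp Φ.smooth _ 1) (by norm_num) hx h
      (fun y hy => (Φ.hasDerivAt_time_comp ht hy).2.deriv) ?_
    refine (hF.fun_mul hT.1).congr_deriv ?_
    ring

lemma logSpeedDeriv_eq (ht : t ∈ positiveTimes T) (hx : x ∈ Icc (-1 : ℝ) 1) :
    logSpeedDeriv Φ.γ t x = -(curv (Φ.γ t) x * evalAt (kds (Φ.γ t)) speedPoly x) := by
  have h := Φ.mem_regularPoints (inTime_of_mem_positiveTimes ht) hx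
  obtain ⟨h0, h1⟩ := Φ.hasDerivAt_time_tangentComp_aux ht hx
  have d := (h0.fun_pow 2).fun_add (h1.fun_pow 2)
  have d' := d.congr_of_eventuallyEq (f₁ := fun _ => (1 : ℝ)) <| by
    filter_upwards [(isOpen_positiveTimes T).mem_nhds ht] with u hu
    exact (tangentComp_sq_add_sq Φ.smooth
      (Φ.mem_regularPoints (inTime_of_mem_positiveTimes hu) hx)).symm
  have e := d'.unique (hasDerivAt_const t 1)
  have n := tangentComp_sq_add_sq Φ.smooth h
  push_cast at e
  linear_combination (-1 / 2) * e - (logSpeedDeriv Φ.γ t x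
    + curv (Φ.γ t) x * evalAt (kds (Φ.γ t)) speedPoly x) * n

lemma hasDerivAt_time_tangentComp (ht : t ∈ positiveTimes T) (hx : x ∈ Icc (-1 : ℝ) 1) :
    HasDerivAt (fun u => tangentComp Φ.γ 0 u x)
        (-(evalAt (kds (Φ.γ t)) (arcDer speedPoly) x * tangentComp Φ.γ 1 t x)) t ∧
      HasDerivAt (fun u => tangentComp Φ.γ 1 u x)
        (evalAt (kds (Φ.γ t)) (arcDer speedPoly) x * tangentComp Φ.γ 0 t x) t := by
  obtain ⟨h0, h1⟩ := Φ.hasDerivAt_time_tangentComp_aux ht hx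
  rw [Φ.logSpeedDeriv_eq ht hx] at h0 h1
  exact ⟨h0.congr_deriv (by ring), h1.congr_deriv (by ring)⟩

lemma hasDerivAt_time_kds (ht : t ∈ positiveTimes T) (j : ℕ) :
    ∀ x ∈ Icc (-1 : ℝ) 1, HasDerivAt (fun u => kds (Φ.γ u) j x)
      (evalAt (kds (Φ.γ t)) (evolPoly j) x) t := by
  have ht' := inTime_of_mem_positiveTimes ht
  have hs := smoothAtPoints_tangentComp Φ.smooth
  induction j with
  | zero =>
    intro x hx
    have h := Φ.mem_regularPoints ht' hx
    have hT := Φ.hasDerivAt_tangentComp ht' hx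
    have hFs := Φ.hasDerivAt_evalAt ht' hx (arcDer speedPoly)
    obtain ⟨d0, d1⟩ := Φ.hasDerivAt_time_tangentComp ht hx
    have a0 := hasDerivAt_time_aderiv Φ.smooth (hs 0) (by norm_num : (-1 : ℝ) < 1) hx h
      (g' := -(evalAt (kds (Φ.γ t)) (arcDer (arcDer speedPoly)) x * tangentComp Φ.γ 1 t x
        + evalAt (kds (Φ.γ t)) (arcDer speedPoly) x
          * (curv (Φ.γ t) x * tangentComp Φ.γ 0 t x)))
      (fun y hy => (Φ.hasDerivAt_time_tangentComp ht hy).1.deriv)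
      ((hFs.fun_mul hT.2).fun_neg.congr_deriv (by ring))
    have a1 := hasDerivAt_time_aderiv Φ.smooth (hs 1) (by norm_num : (-1 : ℝ) < 1) hx h
      (g' := evalAt (kds (Φ.γ t)) (arcDer (arcDer speedPoly)) x * tangentComp Φ.γ 0 t x
        - evalAt (kds (Φ.γ t)) (arcDer speedPoly) x
          * (curv (Φ.γ t) x * tangentComp Φ.γ 1 t x))
      (fun y hy => (Φ.hasDerivAt_time_tangentComp ht hy).2.deriv)
      ((hFs.fun_mul hT.1).congr_deriv (by ring))
    have d := (d0.fun_mul a1).fun_sub (d1.fun_mul a0)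
    have d' := d.congr_of_eventuallyEq (f₁ := fun u => kds (Φ.γ u) 0 x) <| by
      filter_upwards [(isOpen_positiveTimes T).mem_nhds ht] with u hu
      exact curv_eq Φ.smooth (Φ.mem_regularPoints (inTime_of_mem_positiveTimes hu) hx)
    refine d'.congr_deriv ?_
    have n := tangentComp_sq_add_sq Φ.smooth h
    have e : evalAt (kds (Φ.γ t)) (evolPoly 0) x
        = evalAt (kds (Φ.γ t)) (arcDer (arcDer speedPoly)) x
          + curv (Φ.γ t) x ^ 2 * evalAt (kds (Φ.γ t)) speedPoly x := by
      simp [evalAt, evolPoly, kds, aderivIter]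
    rw [e, (aderiv_tangentComp Φ.smooth h).1, (aderiv_tangentComp Φ.smooth h).2,
      Φ.logSpeedDeriv_eq ht hx]
    linear_combination (evalAt (kds (Φ.γ t)) (arcDer (arcDer speedPoly)) x
          + curv (Φ.γ t) x ^ 2 * evalAt (kds (Φ.γ t)) speedPoly x) * n
  | succ j ih =>
    intro x hx
    refine (hasDerivAt_time_aderiv Φ.smooth (smoothAtPoints_kds Φ.smooth j) (by norm_num) hx
      (Φ.mem_regularPoints ht' hx) (fun y hy => (ih y hy).deriv)
      (Φ.hasDerivAt_evalAt ht' hx (evolPoly j))).congr_deriv ?_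
    rw [Φ.logSpeedDeriv_eq ht hx]
    simp [evalAt, evolPoly, kds, aderivIter]

lemma kds_eq_zero_of_odd (hx : x ∈ Icc (-1 : ℝ) 1)
    (hn : ∀ u ∈ positiveTimes T, unormal (Φ.γ u) x 0 = 0)
    (h1 : ∀ u ∈ positiveTimes T, kds (Φ.γ u) 1 x = 0)
    (h3 : ∀ u ∈ positiveTimes T, kds (Φ.γ u) 3 x = 0) (j : ℕ) :
    Odd j → ∀ u ∈ positiveTimes T, kds (Φ.γ u) j x = 0 := by
  induction j using Nat.strong_induction_on with
  | _ j ih =>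
  intro hj u hu
  have hzero : ∀ {d : ℕ} {P : MvPolynomial ℕ ℝ}, HasWeight d P → Odd d → d < j →
      evalAt (kds (Φ.γ u)) P x = 0 := fun hP hd hdj =>
    hP.eval_eq_zero hd fun i hi hid => ih i (by omega) hi u hu
  have hconst : ∀ {f : ℝ → ℝ} {f' : ℝ}, HasDerivAt f f' u →
      (∀ w ∈ positiveTimes T, f w = 0) → f' = 0 := fun hf h0 =>
    (hf.congr_of_eventuallyEq (f₁ := fun _ => (0 : ℝ)) <| by
      filter_upwards [(isOpen_positiveTimes T).mem_nhds hu] with w hw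
      exact (h0 w hw).symm).unique (hasDerivAt_const u 0)
  obtain rfl | rfl | rfl | hj7 : j = 1 ∨ j = 3 ∨ j = 5 ∨ 7 ≤ j := by
    obtain ⟨a, rfl⟩ := hj
    omega
  · exact h1 u hu
  · exact h3 u hu
  · have hβ : ∀ w ∈ positiveTimes T, tangentComp Φ.γ 1 w x = 0 := fun w hw => by
      have := hn w hw
      rwa [unormal_apply_zero Φ.smooth, neg_eq_zero] at this
    have e := hconst (Φ.hasDerivAt_time_tangentComp hu hx).2 hβ
    have n := tangentComp_sq_add_sq Φ.smooth
      (Φ.mem_regularPoints (inTime_of_mem_positiveTimes hu) hx)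
    have hα : tangentComp Φ.γ 0 u x ≠ 0 := fun h0 => by
      rw [h0, hβ u hu] at n
      norm_num at n
    have hF := (mul_eq_zero_iff_right hα).1 e
    have hP := hzero hasWeight_speedPoly_sub.arcDer (by decide) (by norm_num)
    simp only [evalAt, map_sub, arcDer_X, eval_X] at hF hP
    linarith
  · obtain ⟨m, rfl⟩ := Nat.exists_eq_add_of_le' (by omega : 6 ≤ j)
    have hm : Odd m := by
      obtain ⟨a, ha⟩ := hj
      exact ⟨a - 3, by omega⟩
    have e := hconst (Φ.hasDerivAt_time_kds hu m x hx) fun w hw => ih m (by omega) hm w hw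
    have hP := hzero (hasWeight_evolPoly_sub m) (hm.add_even (by decide)) (by omega)
    simp only [evalAt, map_sub, eval_X] at e hP
    linarith

lemma profile {e Λ : ℝ} (B : BC Φ e) (ht : t ∈ positiveTimes T) (hK : totalK (Φ.γ t) = 0)
    (hL : clen (Φ.γ t) ≤ Λ) : Profile (fun x => ‖deriv (Φ.γ t) x‖) (kds (Φ.γ t)) Λ where
  cont x hx := ((smoothAtPoints_speed Φ.smooth).hasDerivAt_space
    (Φ.mem_regularPoints (inTime_of_mem_positiveTimes ht) hx)).continuousAt.continuousWithinAt
  pos x hx := norm_pos_iff.2 (Φ.regular (inTime_of_mem_positiveTimes ht) hx)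
  hasDerivAt j x hx := hasDerivAt_kds Φ.smooth
    (Φ.mem_regularPoints (inTime_of_mem_positiveTimes ht) hx) j
  odd j hj :=
    ⟨Φ.kds_eq_zero_of_odd (by norm_num)
      (fun _ hu => (B.neumann (inTime_of_mem_positiveTimes hu)).1)
      (fun _ hu => (B.noflux (inTime_of_mem_positiveTimes hu)).1)
      (fun _ hu => (B.noflux3 (inTime_of_mem_positiveTimes hu)).1) j hj t ht,
    Φ.kds_eq_zero_of_odd (by norm_num)
      (fun _ hu => (B.neumann (inTime_of_mem_positiveTimes hu)).2)
      (fun _ hu => (B.noflux (inTime_of_mem_positiveTimes hu)).2)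
      (fun _ hu => (B.noflux3 (inTime_of_mem_positiveTimes hu)).2) j hj t ht⟩
  mean := hK
  len := hL

lemma hasDerivAt_knorm2 (ht : inTime T t) (m : ℕ) :
    HasDerivAt (fun u => knorm2 (Φ.γ u) m)
      (∫ x in (-1 : ℝ)..1, deriv (fun u => kds (Φ.γ u) m x ^ 2 * ‖deriv (Φ.γ u) x‖) t) t :=
  hasDerivAt_integral_of_smoothAtPoints (isOpen_regularPoints Φ.smooth)
    (f := fun u x => kds (Φ.γ u) m x ^ 2 * ‖deriv (Φ.γ u) x‖)
    (fun p hp => ((smoothAtPoints_kds Φ.smooth m p hp).pow 2).mul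
      (smoothAtPoints_speed Φ.smooth p hp)) (by norm_num)
    fun _ hx => Φ.mem_regularPoints ht hx

lemma hasDerivAt_knorm2_energy (ht : t ∈ positiveTimes T) (m : ℕ) :
    HasDerivAt (fun u => knorm2 (Φ.γ u) m)
      (wint (fun x => ‖deriv (Φ.γ t) x‖) (evalAt (kds (Φ.γ t)) (energyPoly m))) t := by
  have ht' := inTime_of_mem_positiveTimes ht
  refine (Φ.hasDerivAt_knorm2 ht' m).congr_deriv (integral_congr fun x hx => ?_)
  rw [uIcc_of_le (by norm_num)] at hx
  have h := Φ.mem_regularPoints ht' hx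
  have hv : ‖deriv (Φ.γ t) x‖ ≠ 0 := norm_ne_zero_iff.2 h
  have hs := (smoothAtPoints_speed Φ.smooth).hasDerivAt_time h
  have hW := Φ.logSpeedDeriv_eq ht hx
  rw [logSpeedDeriv, div_eq_iff hv] at hW
  rw [hW] at hs
  have d := ((Φ.hasDerivAt_time_kds ht m x hx).fun_pow 2).fun_mul hs
  simp only [d.deriv, energyPoly, evalAt, map_sub, map_mul, map_pow, eval_X, map_ofNat]
  simp only [kds, aderivIter]
  push_cast
  ring

lemma knorm2_nonneg (ht : inTime T t) (m : ℕ) : 0 ≤ knorm2 (Φ.γ t) m :=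
  wint_nonneg (fun _ hx => norm_pos_iff.2 (Φ.regular ht hx)) fun _ _ => sq_nonneg _

lemma inTime_zero (Φ : SixthFlow T) : inTime T 0 := ⟨le_rfl, by simpa using Φ.Tpos⟩

lemma inTime_of_le {u : ℝ} (ht : inTime T t) (h0 : 0 ≤ u) (hu : u ≤ t) : inTime T u :=
  ⟨h0, (ENNReal.ofReal_le_ofReal hu).trans_lt ht.2⟩

lemma knorm2_le_add_div {m : ℕ} {c M : ℝ} (hc : 0 < c) (hM : 0 ≤ M)
    (h : ∀ t ∈ positiveTimes T,
      wint (fun x => ‖deriv (Φ.γ t) x‖) (evalAt (kds (Φ.γ t)) (energyPoly m)) ≤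
        -c * knorm2 (Φ.γ t) m + M) (ht : inTime T t) :
    knorm2 (Φ.γ t) m ≤ knorm2 (Φ.γ 0) m + M / c := by
  have hpos : ∀ u ∈ Ioo 0 t, u ∈ positiveTimes T := fun u hu =>
    ⟨hu.1, (inTime_of_le ht hu.1.le hu.2.le).2⟩
  exact le_add_div_of_deriv_le (f := fun u => knorm2 (Φ.γ u) m) hc hM ht.1
    (fun u hu => (Φ.hasDerivAt_knorm2 (inTime_of_le ht hu.1 hu.2) m).continuousAt)
    (Φ.knorm2_nonneg Φ.inTime_zero m)
    (fun u hu => Φ.hasDerivAt_knorm2_energy (hpos u hu) m) fun u hu => h u (hpos u hu)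

lemma knorm2_one_le
    (h : ∀ t ∈ positiveTimes T,
      wint (fun x => ‖deriv (Φ.γ t) x‖) (evalAt (kds (Φ.γ t)) (energyPoly 1)) ≤ 0)
    (ht : inTime T t) : knorm2 (Φ.γ t) 1 ≤ knorm2 (Φ.γ 0) 1 := by
  have hpos : ∀ u ∈ Ioo 0 t, u ∈ positiveTimes T := fun u hu =>
    ⟨hu.1, (inTime_of_le ht hu.1.le hu.2.le).2⟩
  refine antitoneOn_of_deriv_nonpos (f := fun u => knorm2 (Φ.γ u) 1) (convex_Icc 0 t)
    (fun u hu => (Φ.hasDerivAt_knorm2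
      (inTime_of_le ht hu.1 hu.2) 1).continuousAt.continuousWithinAt)
    (fun u hu => ?_) (fun u hu => ?_) (left_mem_Icc.2 ht.1) (right_mem_Icc.2 ht.1) ht.1
  all_goals rw [interior_Icc] at hu
  · exact (Φ.hasDerivAt_knorm2_energy (hpos u hu) 1).differentiableAt.differentiableWithinAt
  · rw [(Φ.hasDerivAt_knorm2_energy (hpos u hu) 1).deriv]
    exact h u (hpos u hu)

end SixthFlow

end Dynamics

/-- **Uniform bounds on all curvature derivatives in `L²`.**  If under the flow `ω(t) = 0`
and `|e| ≤ L(t) ≤ L₀` for all `t ∈ [0,T)`, where `L₀ = L(0)`, then for every `ℓ ∈ ℕ` there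
is a constant `C > 0` (depending only on `ℓ`, `L₀`, `|e|` and the initial data) with
`‖k_{s^ℓ}(·,t)‖₂² ≤ ‖k_{s^ℓ}(·,0)‖₂² + C` for all `t ∈ [0,T)`. -/
theorem curvature_derivatives_L2_bound {T : ℝ≥0∞} (Φ : SixthFlow T) (e : ℝ) (B : BC Φ e)
    (hyp : ∀ t : ℝ, inTime T t →
      1 / (2 * π) * totalK (Φ.γ t) = 0 ∧
      |e| ≤ clen (Φ.γ t) ∧ clen (Φ.γ t) ≤ clen (Φ.γ 0)) :
    ∀ ℓ : ℕ, ∃ C : ℝ, 0 < C ∧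
      ∀ t : ℝ, inTime T t → knorm2 (Φ.γ t) ℓ ≤ knorm2 (Φ.γ 0) ℓ + C := by
  have hpr : ∀ t ∈ positiveTimes T,
      Profile (fun x => ‖deriv (Φ.γ t) x‖) (kds (Φ.γ t)) (clen (Φ.γ 0)) := fun t ht => by
    obtain ⟨hω, -, hL⟩ := hyp t (inTime_of_mem_positiveTimes ht)
    exact Φ.profile B ht ((mul_eq_zero_iff_left (by positivity)).1 hω) hL
  have hΛ : 0 ≤ clen (Φ.γ 0) := (abs_nonneg e).trans (hyp 0 Φ.inTime_zero).2.1
  intro ℓ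
  induction ℓ using Nat.strong_induction_on with
  | _ ℓ ih =>
  have h1 : ∀ t, inTime T t → knorm2 (Φ.γ t) 1 ≤ knorm2 (Φ.γ 0) 1 := fun t ht =>
    Φ.knorm2_one_le (fun u hu => (hpr u hu).wint_energyPoly_one_nonpos) ht
  match ℓ with
  | 0 =>
    set b := √(knorm2 (Φ.γ 0) 1) with hb
    have hbsq : b ^ 2 = knorm2 (Φ.γ 0) 1 := Real.sq_sqrt (Φ.knorm2_nonneg Φ.inTime_zero 1)
    have h0 := Φ.knorm2_nonneg Φ.inTime_zero 0
    refine ⟨((1 + clen (Φ.γ 0)) * b) ^ 2 * clen (Φ.γ 0) + 1, by positivity, fun t ht => ?_⟩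
    rcases ht.1.eq_or_lt with rfl | hpos
    · have : 0 ≤ ((1 + clen (Φ.γ 0)) * b) ^ 2 * clen (Φ.γ 0) := by positivity
      linarith
    · have := (hpr t ⟨hpos, ht.2⟩).wint_zero_sq_le (Real.sqrt_nonneg _)
        ((h1 t ht).trans_eq hbsq.symm)
      change knorm2 (Φ.γ t) 0 ≤ _ at this
      linarith
  | 1 => exact ⟨1, one_pos, fun t ht => (h1 t ht).trans (by linarith)⟩
  | n + 2 =>
    choose! C hC hCb using ih
    set A := ∑ j ∈ Finset.range (n + 2), (knorm2 (Φ.γ 0) j + C j) with hA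
    have hnn : ∀ j ∈ Finset.range (n + 2), 0 ≤ knorm2 (Φ.γ 0) j + C j := fun j hj =>
      add_nonneg (Φ.knorm2_nonneg Φ.inTime_zero j) (hC j (Finset.mem_range.1 hj)).le
    have hA0 : 0 ≤ A := Finset.sum_nonneg hnn
    obtain ⟨c, M, hc, hM, hcM⟩ := exists_dissipation n (clen (Φ.γ 0)) (1 + A) hΛ (by linarith)
    refine ⟨M / c + 1, by positivity, fun t ht => ?_⟩
    have := Φ.knorm2_le_add_div (m := n + 2) hc hM
      (fun u hu => hcM _ _ (hpr u hu) fun j hj => ?_) ht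
    · linarith
    · have hj' : j < n + 2 := by omega
      refine (hCb j hj' u (inTime_of_mem_positiveTimes hu)).trans ?_
      have := Finset.single_le_sum hnn (Finset.mem_range.2 hj')
      nlinarith
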